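/- arXiv:1903.01002 — 2 statements merged into one kernel-verified Lean document; each statement's English description precedes it below -/
import Mathlib

section
/- Let r ≥ 2 and let F be a graph obtained from a graph F_0 by subdividing one edge. Then for every n, the maximum number of hyperedges in an r-uniform Berge-F-free hypergraph on n vertices satisfies ex_r(n, Berge-F) ≤ ex(n, K_r, F) + 2^{r-1}·ex(n, F_0) + ex_r^{lin}(n, Berge-F). -/
open scoped Classical

/-- `G` contains a copy of `F`, i.e. a subgraph isomorphic to `F`. -/
def HasCopy {α V : Type*} (F : SimpleGraph α) (G : SimpleGraph V) : Prop :=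
  ∃ φ : α ↪ V, ∀ ⦃a b : α⦄, F.Adj a b → G.Adj (φ a) (φ b)

/-- `N(K_r, G)`: the number of copies of the complete graph `K_r` in `G`,
i.e. the number of `r`-cliques of `G`. -/
noncomputable def cliqueCount {V : Type*} (r : ℕ) (G : SimpleGraph V) : ℕ :=
  {s : Finset V | G.IsNClique r s}.ncard

/-- The number of edges of `G`. -/
noncomputable def edgeCount {V : Type*} (G : SimpleGraph V) : ℕ :=
  G.edgeSet.ncard

/-- The Turán number `ex(n, F)`: the maximum number of edges in an `F`-free graph
on `n` vertices. -/
noncomputable def exTuran {α : Type*} (n : ℕ) (F : SimpleGraph α) : ℕ :=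
  sSup {m | ∃ G : SimpleGraph (Fin n), ¬ HasCopy F G ∧ edgeCount G = m}

/-- The generalized Turán number `ex(n, K_r, F)`: the maximum number of copies of `K_r`
in an `F`-free graph on `n` vertices. -/
noncomputable def exClique {α : Type*} (n r : ℕ) (F : SimpleGraph α) : ℕ :=
  sSup {m | ∃ G : SimpleGraph (Fin n), ¬ HasCopy F G ∧ cliqueCount r G = m}

/-- The hypergraph `H` contains a Berge copy of the graph `F`: there is an injection `φ`
of the vertices of `F` and an injection `f` from the edges of `F` to the hyperedges of `H`
such that `φ '' e ⊆ f e` for every edge `e` of `F`. -/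
def HasBergeCopy {α V : Type*} (F : SimpleGraph α) (H : Finset (Finset V)) : Prop :=
  ∃ (φ : α ↪ V) (f : F.edgeSet → Finset V), Function.Injective f ∧
    ∀ e : F.edgeSet, f e ∈ H ∧ ∀ x ∈ (e : Sym2 α), φ x ∈ f e

/-- `ex_r(n, Berge-F)`: the maximum number of hyperedges in an `r`-uniform
Berge-`F`-free hypergraph on `n` vertices. -/
noncomputable def exBerge {α : Type*} (r n : ℕ) (F : SimpleGraph α) : ℕ :=
  sSup {m | ∃ H : Finset (Finset (Fin n)), (∀ e ∈ H, e.card = r) ∧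
    ¬ HasBergeCopy F H ∧ H.card = m}

/-- A hypergraph is linear if any two distinct hyperedges share at most one vertex. -/
def IsLinear {V : Type*} [DecidableEq V] (H : Finset (Finset V)) : Prop :=
  ∀ e₁ ∈ H, ∀ e₂ ∈ H, e₁ ≠ e₂ → (e₁ ∩ e₂).card ≤ 1

/-- `ex_r^{lin}(n, Berge-F)`: the maximum number of hyperedges in an `r`-uniform linear
Berge-`F`-free hypergraph on `n` vertices. -/
noncomputable def exBergeLin {α : Type*} (r n : ℕ) (F : SimpleGraph α) : ℕ :=
  sSup {m | ∃ H : Finset (Finset (Fin n)), (∀ e ∈ H, e.card = r) ∧ IsLinear H ∧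
    ¬ HasBergeCopy F H ∧ H.card = m}

/-- The graph obtained from `F₀` by subdividing the edge `uv`: delete the edge `uv` and
add a new vertex `none` joined to `u` and `v`. -/
def subdivideEdge {α : Type*} (F₀ : SimpleGraph α) (u v : α) : SimpleGraph (Option α) :=
  SimpleGraph.fromEdgeSet
    ((Sym2.map some '' F₀.edgeSet \ {s(some u, some v)}) ∪ {s(some u, none), s(some v, none)})

/-- The graph whose edges are the two-element sets in `M`. -/
def pairGraph {n : ℕ} (M : Set (Finset (Fin n))) : SimpleGraph (Fin n) where
  Adj a b := a ≠ b ∧ ({a, b} : Finset (Fin n)) ∈ M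
  symm := ⟨fun a b h => ⟨h.1.symm, by rw [Finset.pair_comm]; exact h.2⟩⟩
  loopless := ⟨fun a h => h.1 rfl⟩

lemma not_copy_of_berge {β : Type*} {n : ℕ} (F : SimpleGraph β) (H : Finset (Finset (Fin n)))
    (M : Set (Finset (Fin n))) (τ : Finset (Fin n) → Finset (Fin n))
    (hτ : ∀ π ∈ M, τ π ∈ H ∧ π ⊆ τ π) (hinj : Set.InjOn τ M) (hF : ¬ HasBergeCopy F H) :
    ¬ HasCopy F (pairGraph M) := by
  rintro ⟨φ, hφ⟩
  apply hF
  have key : ∀ e ∈ F.edgeSet, (Sym2.map φ e).toFinset ∈ M := by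
    intro e he
    induction e using Sym2.inductionOn with
    | _ a b =>
      have := (hφ (by simpa using he)).2
      rw [Sym2.map_mk, Sym2.toFinset_mk_eq]
      exact this
  refine ⟨φ, fun e => τ ((Sym2.map φ e).toFinset), ?_, ?_⟩
  · intro e e' h
    have h1 := hinj (key e e.2) (key e' e'.2) h
    apply Subtype.ext
    apply Sym2.map.injective φ.injective
    apply Sym2.ext
    intro x
    rw [← Sym2.mem_toFinset, h1, Sym2.mem_toFinset]
  · intro e
    refine ⟨(hτ _ (key e e.2)).1, fun x hx => (hτ _ (key e e.2)).2 ?_⟩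
    rw [Sym2.mem_toFinset, Sym2.mem_map]
    exact ⟨x, hx, rfl⟩

lemma card_le_edgeCount {n : ℕ} (M : Finset (Finset (Fin n))) (hM : ∀ π ∈ M, π.card = 2) :
    M.card ≤ edgeCount (pairGraph (M : Set (Finset (Fin n)))) := by
  have hsub : (M : Set (Finset (Fin n))) ⊆
      (fun e : Sym2 (Fin n) => e.toFinset) '' (pairGraph (M : Set (Finset (Fin n)))).edgeSet := by
    intro π hπ
    obtain ⟨a, b, hab, rfl⟩ := Finset.card_eq_two.1 (hM π hπ)
    exact ⟨s(a, b), ⟨hab, hπ⟩, Sym2.toFinset_mk_eq⟩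
  rw [← Set.ncard_coe_finset]
  exact (Set.ncard_le_ncard hsub (Set.toFinite _)).trans (Set.ncard_image_le (Set.toFinite _))

lemma le_exTuran {α : Type*} {n : ℕ} (F : SimpleGraph α) (G : SimpleGraph (Fin n))
    (h : ¬ HasCopy F G) : edgeCount G ≤ exTuran n F := by
  apply le_csSup
  · apply Set.Finite.bddAbove
    apply (Set.finite_range (fun G : SimpleGraph (Fin n) => edgeCount G)).subset
    rintro m ⟨G, -, rfl⟩
    exact ⟨G, rfl⟩
  · exact ⟨G, h, rfl⟩

lemma le_exClique {α : Type*} {n : ℕ} (r : ℕ) (F : SimpleGraph α) (G : SimpleGraph (Fin n))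
    (h : ¬ HasCopy F G) : cliqueCount r G ≤ exClique n r F := by
  apply le_csSup
  · apply Set.Finite.bddAbove
    apply (Set.finite_range (fun G : SimpleGraph (Fin n) => cliqueCount r G)).subset
    rintro m ⟨G, -, rfl⟩
    exact ⟨G, rfl⟩
  · exact ⟨G, h, rfl⟩

lemma berge_mono {α : Type*} {n : ℕ} (F : SimpleGraph α) {H H' : Finset (Finset (Fin n))}
    (hs : H' ⊆ H) (h : ¬ HasBergeCopy F H) : ¬ HasBergeCopy F H' := by
  rintro ⟨φ, f, hf, h'⟩
  exact h ⟨φ, f, hf, fun e => ⟨hs (h' e).1, (h' e).2⟩⟩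

lemma le_exBergeLin {α : Type*} {n : ℕ} (r : ℕ) (F : SimpleGraph α)
    (L : Finset (Finset (Fin n))) (hr : ∀ e ∈ L, e.card = r) (hL : IsLinear L)
    (h : ¬ HasBergeCopy F L) : L.card ≤ exBergeLin r n F := by
  apply le_csSup
  · apply Set.Finite.bddAbove
    apply (Set.finite_range (fun L : Finset (Finset (Fin n)) => L.card)).subset
    rintro m ⟨L, -, -, -, rfl⟩
    exact ⟨L, rfl⟩
  · exact ⟨L, hr, hL, h, rfl⟩

/-- Hyperedges all of whose pairs are represented by distinct hyperedges. -/
lemma clique_bound {β : Type*} {n : ℕ} (r : ℕ) (F : SimpleGraph β) (H : Finset (Finset (Fin n)))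
    (hF : ¬ HasBergeCopy F H) (D : Finset (Finset (Fin n))) (hD : D ⊆ H)
    (p : Finset (Fin n) → Finset (Fin n)) (hsub : ∀ e ∈ D, p e ⊆ e)
    (C : Finset (Finset (Fin n))) (hC : ∀ e ∈ C, e.card = r)
    (hCp : ∀ e ∈ C, ∀ π ⊆ e, π.card = 2 → ∃ d ∈ D, p d = π) :
    C.card ≤ exClique n r F := by
  have hinv : ∀ π ∈ p '' (D : Set (Finset (Fin n))), ∃ e ∈ D, p e = π := by
    rintro π ⟨e, he, rfl⟩
    exact ⟨e, he, rfl⟩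
  choose! τ hτ1 hτ2 using hinv
  have hfree := not_copy_of_berge F H (p '' (D : Set (Finset (Fin n)))) τ
    (fun π hπ => ⟨hD (hτ1 π hπ), by
      have := hsub _ (hτ1 π hπ)
      rwa [hτ2 π hπ] at this⟩)
    (fun π hπ π' hπ' h => by rw [← hτ2 π hπ, ← hτ2 π' hπ', h]) hF
  refine le_trans ?_ (le_exClique r F _ hfree)
  rw [← Set.ncard_coe_finset, cliqueCount]
  apply Set.ncard_le_ncard _ (Set.toFinite _)
  intro e he
  refine ⟨?_, hC e he⟩
  intro a ha b hb hab
  refine ⟨hab, ?_⟩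
  obtain ⟨d, hd, h⟩ := hCp e he {a, b} (by
    intro x hx
    simp only [Finset.mem_insert, Finset.mem_singleton] at hx
    rcases hx with rfl | rfl
    · exact ha
    · exact hb) (Finset.card_pair hab)
  exact ⟨d, hd, h⟩

/-- The main embedding lemma: a graph with represented edges, each of which can be subdivided
outside of `A`, has at most `ex(n, F₀)` edges. -/
lemma turan_bound {α : Type*} {n : ℕ} (F₀ : SimpleGraph α) (u v : α) (huv : F₀.Adj u v)
    (hemb : Nonempty (Option α ↪ Fin n))
    (H : Finset (Finset (Fin n))) (hF : ¬ HasBergeCopy (subdivideEdge F₀ u v) H)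
    (A : Finset (Fin n)) (M : Finset (Finset (Fin n)))
    (Rep : Finset (Fin n) → Finset (Fin n) → Prop)
    (hM2 : ∀ π ∈ M, π.card = 2) (hMA : ∀ π ∈ M, π ⊆ A)
    (hrep : ∀ π ∈ M, ∃ e ∈ H, π ⊆ e ∧ Rep π e)
    (huniq : ∀ π ∈ M, ∀ π' ∈ M, ∀ e, Rep π e → Rep π' e → π = π')
    (hpath : ∀ π ∈ M, ∃ x ∉ A, ∃ a b, π = {a, b} ∧ ∃ f₁ ∈ H, ∃ f₂ ∈ H, f₁ ≠ f₂ ∧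
      a ∈ f₁ ∧ x ∈ f₁ ∧ x ∈ f₂ ∧ b ∈ f₂ ∧
      ∀ π' ∈ M, π' ≠ π → ¬ Rep π' f₁ ∧ ¬ Rep π' f₂) :
    M.card ≤ exTuran n F₀ := by
  refine (card_le_edgeCount M hM2).trans (le_exTuran F₀ _ ?_)
  rintro ⟨φ₀, hφ₀⟩
  choose! ρ hρH hρs hρR using hrep
  have hπ : ({φ₀ u, φ₀ v} : Finset (Fin n)) ∈ M := (hφ₀ huv).2
  have huvne : φ₀ u ≠ φ₀ v := (hφ₀ huv).1
  obtain ⟨x, hxA, a, b, hab, f₁, hf₁, f₂, hf₂, hne, ha1, hx1, hx2, hb2, hnr⟩ := hpath _ hπ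
  -- a vertex outside the range
  obtain ⟨v0, hv0⟩ : ∃ v0, v0 ∉ Set.range φ₀ := by
    by_contra hcon
    push Not at hcon
    obtain ⟨ψ⟩ := hemb
    have hfa : Finite (Option α) := Finite.of_injective ψ ψ.injective
    have hfa' : Finite α := Finite.of_injective φ₀ φ₀.injective
    have h1 := Nat.card_le_card_of_injective ψ ψ.injective
    have h2 := Nat.card_le_card_of_surjective φ₀ hcon
    rw [Finite.card_option] at h1
    omega
  have hφ : ∃ φ : α ↪ Fin n, (∀ i, φ i ≠ x) ∧ ∀ i j, F₀.Adj i j → φ i = φ₀ i := by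
    refine ⟨φ₀.trans (Equiv.swap x v0).toEmbedding, ?_, ?_⟩
    · intro i h
      simp only [Function.Embedding.trans_apply, Equiv.coe_toEmbedding] at h
      have : φ₀ i = v0 := by
        apply (Equiv.swap x v0).injective
        rw [h, Equiv.swap_apply_right]
      exact hv0 ⟨i, this⟩
    · intro i j hij
      simp only [Function.Embedding.trans_apply, Equiv.coe_toEmbedding]
      apply Equiv.swap_apply_of_ne_of_ne
      · rintro rfl
        exact hxA (hMA _ (hφ₀ hij).2 (by simp))
      · rintro h
        exact hv0 ⟨i, h⟩
  obtain ⟨φ, hφx, hφe⟩ := hφ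
  have hπsub := hMA _ hπ
  have hxπ : ∀ π ∈ M, x ∉ π := fun π h hx => hxA (hMA π h hx)
  have haA : a ∈ A := hπsub (by rw [hab]; simp)
  have hbA : b ∈ A := hπsub (by rw [hab]; simp)
  have hab' : a ≠ b := by
    rintro rfl
    have := hM2 _ hπ
    rw [hab] at this
    simp at this
  have hax : a ≠ x := by rintro rfl; exact hxA haA
  have hbx : b ≠ x := by rintro rfl; exact hxA hbA
  have hp12 : ({a, x} : Finset (Fin n)) ≠ {b, x} := by
    intro h
    have : a ∈ ({b, x} : Finset (Fin n)) := by rw [← h]; simp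
    simp [hab', hax] at this
  let τ : Finset (Fin n) → Finset (Fin n) := fun π =>
    if π = {a, x} then f₁ else if π = {b, x} then f₂ else ρ π
  let E : Set (Finset (Fin n)) := {π | π = {a, x} ∨ π = {b, x} ∨ (π ∈ M ∧ π ≠ {φ₀ u, φ₀ v})}
  have hMne : ∀ π ∈ M, π ≠ {a, x} ∧ π ≠ {b, x} := by
    intro π h
    constructor <;> (rintro rfl; exact hxπ _ h (by simp))
  have hτ1 : τ {a, x} = f₁ := by simp [τ]
  have hτ2 : τ {b, x} = f₂ := by simp [τ, hp12.symm]
  have hτ3 : ∀ π ∈ M, τ π = ρ π := by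
    intro π h
    simp [τ, (hMne π h).1, (hMne π h).2]
  refine not_copy_of_berge (subdivideEdge F₀ u v) H E τ ?_ ?_ hF ?_
  · rintro π (rfl | rfl | ⟨h, -⟩)
    · rw [hτ1]
      refine ⟨hf₁, ?_⟩
      intro y; simp only [Finset.mem_insert, Finset.mem_singleton]; rintro (rfl | rfl) <;> assumption
    · rw [hτ2]
      refine ⟨hf₂, ?_⟩
      intro y; simp only [Finset.mem_insert, Finset.mem_singleton]; rintro (rfl | rfl) <;> assumption
    · rw [hτ3 π h]
      exact ⟨hρH π h, hρs π h⟩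
  · rintro π (rfl | rfl | ⟨h, h'⟩) π' (rfl | rfl | ⟨k, k'⟩) heq
    · rfl
    · rw [hτ1, hτ2] at heq; exact absurd heq hne
    · rw [hτ1, hτ3 _ k] at heq
      exact absurd (hρR _ k) (heq ▸ (hnr _ k k').1)
    · rw [hτ1, hτ2] at heq; exact absurd heq.symm hne
    · rfl
    · rw [hτ2, hτ3 _ k] at heq
      exact absurd (hρR _ k) (heq ▸ (hnr _ k k').2)
    · rw [hτ1, hτ3 _ h] at heq
      exact absurd (hρR _ h) (heq ▸ (hnr _ h h').1)
    · rw [hτ2, hτ3 _ h] at heq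
      exact absurd (hρR _ h) (heq ▸ (hnr _ h h').2)
    · rw [hτ3 _ h, hτ3 _ k] at heq
      exact huniq _ h _ k (ρ π) (hρR _ h) (heq ▸ hρR _ k)
  · -- the copy of the subdivided graph
    have hu : φ u = φ₀ u := hφe _ _ huv
    have hv : φ v = φ₀ v := hφe _ _ huv.symm
    let ψ : Option α → Fin n := fun o => o.elim x φ
    have hψ : Function.Injective ψ := by
      intro i j h
      cases i <;> cases j
      · rfl
      · exact absurd h.symm (hφx _)
      · exact absurd h (hφx _)
      · exact congrArg some (φ.injective h)
    have hEx : ∀ c, c = φ₀ u ∨ c = φ₀ v → c ≠ x ∧ ({c, x} : Finset (Fin n)) ∈ E := by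
      intro c hc
      have : c ∈ ({a, b} : Finset (Fin n)) := by
        rw [← hab]; simpa using hc
      simp only [Finset.mem_insert, Finset.mem_singleton] at this
      rcases this with rfl | rfl
      · exact ⟨hax, Or.inl rfl⟩
      · exact ⟨hbx, Or.inr (Or.inl rfl)⟩
    refine ⟨⟨ψ, hψ⟩, ?_⟩
    intro i j hij
    rw [subdivideEdge, SimpleGraph.fromEdgeSet_adj] at hij
    obtain ⟨hij, hijne⟩ := hij
    change (pairGraph E).Adj (ψ i) (ψ j)
    rcases hij with ⟨⟨e, he, hmap⟩, hnot⟩ | hij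
    · induction e using Sym2.inductionOn with
      | _ c d =>
        have hcd : F₀.Adj c d := by simpa using he
        have hnuv : s(c, d) ≠ s(u, v) := by
          intro h
          apply hnot
          rw [← hmap, h]; rfl
        have hfin : (pairGraph E).Adj (ψ (some c)) (ψ (some d)) := by
          change (pairGraph E).Adj (φ c) (φ d)
          rw [hφe _ _ hcd, hφe _ _ hcd.symm]
          refine ⟨(hφ₀ hcd).1, Or.inr (Or.inr ⟨(hφ₀ hcd).2, ?_⟩)⟩
          intro h
          apply hnuv
          apply Sym2.map.injective φ₀.injective
          apply Sym2.ext
          intro y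
          rw [← Sym2.mem_toFinset, ← Sym2.mem_toFinset, Sym2.map_mk, Sym2.map_mk,
            Sym2.toFinset_mk_eq, Sym2.toFinset_mk_eq, h]
        rw [Sym2.map_mk, Sym2.eq_iff] at hmap
        rcases hmap with ⟨rfl, rfl⟩ | ⟨rfl, rfl⟩
        · exact hfin
        · exact hfin.symm
    · have h1 : (pairGraph E).Adj (ψ (some u)) (ψ none) := by
        change (pairGraph E).Adj (φ u) x
        rw [hu]; exact hEx _ (Or.inl rfl)
      have h2 : (pairGraph E).Adj (ψ (some v)) (ψ none) := by
        change (pairGraph E).Adj (φ v) x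
        rw [hv]; exact hEx _ (Or.inr rfl)
      simp only [Set.mem_insert_iff, Set.mem_singleton_iff, Sym2.eq_iff] at hij
      rcases hij with (⟨rfl, rfl⟩ | ⟨rfl, rfl⟩) | (⟨rfl, rfl⟩ | ⟨rfl, rfl⟩)
      · exact h1
      · exact h1.symm
      · exact h2
      · exact h2.symm

lemma sum_weight_sup {n : ℕ} (p : ℝ) (T : Finset (Fin n)) :
    ∑ A : Finset (Fin n) with T ⊆ A, p ^ A.card * (1 - p) ^ (Finset.univ \ A).card
      = p ^ T.card := by
  have h := Finset.prod_add (fun _ : Fin n => p) (fun i => if i ∈ T then 0 else 1 - p) Finset.univ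
  have h1 : ∏ i : Fin n, (p + if i ∈ T then 0 else 1 - p) = p ^ T.card := by
    have : ∀ i : Fin n, (p + if i ∈ T then 0 else 1 - p) = if i ∈ T then p else 1 := by
      intro i; split_ifs <;> ring
    simp_rw [this]
    rw [Finset.prod_ite]
    simp
  rw [h1] at h
  rw [h, Finset.powerset_univ, Finset.sum_filter]
  apply Finset.sum_congr rfl
  intro A _
  split_ifs with hA
  · rw [Finset.prod_const]
    congr 1
    rw [← Finset.prod_const]
    apply Finset.prod_congr rfl
    intro i hi
    rw [if_neg]
    intro hiT
    exact (Finset.mem_sdiff.1 hi).2 (hA hiT)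
  · obtain ⟨i, hiT, hiA⟩ := Finset.not_subset.1 hA
    have h0 : (∏ i ∈ Finset.univ \ A, if i ∈ T then 0 else 1 - p) = 0 :=
      Finset.prod_eq_zero (i := i) (by simp [hiA]) (by simp [hiT])
    rw [h0, mul_zero]

/-- A probability measure on subsets of the vertex set. -/
lemma exists_weight (n : ℕ) : ∃ w : Finset (Fin n) → ℝ, (∀ A, 0 ≤ w A) ∧ ∑ A, w A = 1 ∧
    (∀ (π : Finset (Fin n)) (x : Fin n), π.card = 2 → x ∉ π →
      1 / 8 ≤ ∑ A : Finset (Fin n) with (π ⊆ A ∧ x ∉ A), w A) ∧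
    (∀ (π : Finset (Fin n)) (x y : Fin n), π.card = 2 → x ∉ π → y ∉ π → x ≠ y →
      1 / 4 ≤ ∑ A : Finset (Fin n) with (π ⊆ A ∧ (x ∉ A ∨ y ∉ A)), w A) := by
  set p : ℝ := √2 / 2 with hp
  have hp2 : p ^ 2 = 1 / 2 := by
    rw [hp, div_pow, Real.sq_sqrt (by norm_num)]; norm_num
  have hp0 : 0 ≤ p := by positivity
  have hp1 : p ≤ 3 / 4 := by nlinarith
  let w : Finset (Fin n) → ℝ := fun A => p ^ A.card * (1 - p) ^ (Finset.univ \ A).card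
  have hw : ∀ T : Finset (Fin n), ∑ A : Finset (Fin n) with T ⊆ A, w A = p ^ T.card :=
    sum_weight_sup p
  have hdiff : ∀ π T : Finset (Fin n), ∑ A : Finset (Fin n) with (π ⊆ A ∧ ¬ T ⊆ A), w A
      = p ^ π.card - p ^ (π ∪ T).card := by
    intro π T
    rw [← hw π, ← hw (π ∪ T), eq_sub_iff_add_eq,
      ← Finset.sum_filter_add_sum_filter_not (Finset.univ.filter (π ⊆ ·)) (fun A => ¬ T ⊆ A),
      Finset.filter_filter, Finset.filter_filter]
    congr 1
    apply Finset.sum_congr _ (fun _ _ => rfl)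
    ext A
    simp [Finset.union_subset_iff]
  refine ⟨w, ?_, ?_, ?_, ?_⟩
  · intro A
    have : 0 ≤ 1 - p := by linarith
    positivity
  · have := hw ∅
    simpa using this
  · intro π x hπ hx
    have h := hdiff π {x}
    rw [hπ, Finset.union_comm, Finset.singleton_union, Finset.card_insert_of_notMem hx, hπ] at h
    simp only [Finset.singleton_subset_iff] at h
    rw [h]
    nlinarith
  · intro π x y hπ hx hy hxy
    have h := hdiff π {x, y}
    have hc : (π ∪ {x, y}).card = 4 := by
      rw [Finset.card_union_of_disjoint, hπ, Finset.card_pair hxy]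
      simp [hx, hy]
    rw [hπ, hc] at h
    have : ∀ A : Finset (Fin n), ¬ ({x, y} : Finset (Fin n)) ⊆ A ↔ (x ∉ A ∨ y ∉ A) := by
      intro A
      rw [Finset.insert_subset_iff, Finset.singleton_subset_iff]
      tauto
    simp only [this] at h
    rw [h]
    nlinarith

lemma averaging {n : ℕ} (w : Finset (Fin n) → ℝ) (hw : ∀ A, 0 ≤ w A) (hw1 : ∑ A, w A = 1)
    (M : Finset (Fin n) → Finset (Finset (Fin n))) (E : ℕ) (hE : ∀ A, (M A).card ≤ E)
    (S : Finset (Finset (Fin n))) (c : Finset (Fin n) → ℝ)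
    (hc : ∀ π ∈ S, c π ≤ ∑ A : Finset (Fin n) with π ∈ M A, w A) :
    ∑ π ∈ S, c π ≤ E := by
  calc ∑ π ∈ S, c π ≤ ∑ π ∈ S, ∑ A : Finset (Fin n) with π ∈ M A, w A :=
        Finset.sum_le_sum hc
    _ = ∑ A : Finset (Fin n), ∑ π ∈ S with π ∈ M A, w A := by
        simp_rw [Finset.sum_filter]
        exact Finset.sum_comm
    _ ≤ ∑ A : Finset (Fin n), E * w A := by
        apply Finset.sum_le_sum
        intro A _
        rw [Finset.sum_const, nsmul_eq_mul]
        apply mul_le_mul_of_nonneg_right _ (hw A)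
        have : (S.filter (· ∈ M A)).card ≤ (M A).card :=
          Finset.card_le_card (fun π h => (Finset.mem_filter.1 h).2)
        exact_mod_cast this.trans (hE A)
    _ = E := by rw [← Finset.mul_sum, hw1, mul_one]

/-- Greedy matching of hyperedges to admissible pairs. -/
lemma greedy {V : Type*} (X : Finset V) (Adm : V → V → Prop) (B : Set V) :
    ∃ (D : Finset V) (p : V → V), D ⊆ X ∧ Set.InjOn p D ∧ (∀ e ∈ D, Adm e (p e) ∧ p e ∉ B) ∧
      ∀ e ∈ X, e ∉ D → ∀ π, Adm e π → π ∈ B ∨ ∃ d ∈ D, p d = π := by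
  induction X using Finset.induction_on with
  | empty => exact ⟨∅, id, by simp, by simp, by simp, by simp⟩
  | insert a X ha ih =>
    obtain ⟨D, p, hDX, hinj, hadm, hrest⟩ := ih
    by_cases h : ∃ π, Adm a π ∧ π ∉ B ∧ ∀ d ∈ D, p d ≠ π
    · obtain ⟨π, h1, h2, h3⟩ := h
      have haD : a ∉ D := fun h => ha (hDX h)
      have hne : ∀ d ∈ D, d ≠ a := fun d hd h => haD (h ▸ hd)
      have hold : ∀ d ∈ D, Function.update p a π d = p d := fun d hd =>
        Function.update_of_ne (hne d hd) _ _
      refine ⟨insert a D, Function.update p a π, Finset.insert_subset_insert _ hDX, ?_, ?_, ?_⟩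
      · intro x hx y hy hxy
        simp only [Finset.coe_insert, Set.mem_insert_iff, Finset.mem_coe] at hx hy
        rcases hx with rfl | hx <;> rcases hy with rfl | hy
        · rfl
        · rw [Function.update_self, hold y hy] at hxy
          exact absurd hxy.symm (h3 y hy)
        · rw [Function.update_self, hold x hx] at hxy
          exact absurd hxy (h3 x hx)
        · rw [hold x hx, hold y hy] at hxy
          exact hinj hx hy hxy
      · intro e he
        rcases Finset.mem_insert.1 he with rfl | he
        · rw [Function.update_self]; exact ⟨h1, h2⟩
        · rw [hold e he]; exact hadm e he
      · intro e he heD π' hπ'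
        rw [Finset.mem_insert, not_or] at heD
        have heX := Finset.mem_of_mem_insert_of_ne he heD.1
        rcases hrest e heX heD.2 π' hπ' with h | ⟨d, hd, h⟩
        · exact Or.inl h
        · exact Or.inr ⟨d, Finset.mem_insert_of_mem hd, by rw [hold d hd, h]⟩
    · push Not at h
      refine ⟨D, p, hDX.trans (Finset.subset_insert _ _), hinj, hadm, ?_⟩
      intro e he heD π hπ
      rcases Finset.mem_insert.1 he with rfl | he
      · by_cases hB : π ∈ B
        · exact Or.inl hB
        · exact Or.inr (h π hπ hB)
      · exact hrest e he heD π hπ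

/-- A maximal linear subfamily. -/
lemma exists_maximal_linear {n : ℕ} (X : Finset (Finset (Fin n))) :
    ∃ L ⊆ X, IsLinear L ∧ ∀ e ∈ X, e ∉ L → ∃ l ∈ L, l ≠ e ∧ 2 ≤ (e ∩ l).card := by
  obtain ⟨L, hL, hmax⟩ := Finset.exists_max_image (X.powerset.filter (fun L => IsLinear L))
    Finset.card ⟨∅, Finset.mem_filter.2 ⟨by simp, by simp [IsLinear]⟩⟩
  rw [Finset.mem_filter, Finset.mem_powerset] at hL
  refine ⟨L, hL.1, hL.2, ?_⟩
  intro e he heL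
  by_contra hcon
  push Not at hcon
  have hlin : IsLinear (insert e L) := by
    intro a ha b hb hab
    rcases Finset.mem_insert.1 ha with rfl | ha' <;> rcases Finset.mem_insert.1 hb with rfl | hb'
    · exact absurd rfl hab
    · have := hcon b hb' hab.symm
      omega
    · have := hcon a ha' hab
      rw [Finset.inter_comm] at this
      omega
    · exact hL.2 a ha' b hb' hab
  have := hmax (insert e L) (Finset.mem_filter.2 ⟨Finset.mem_powerset.2
    (Finset.insert_subset he hL.1), hlin⟩)
  rw [Finset.card_insert_of_notMem heL] at this
  omega

lemma case_general {α : Type*} {n : ℕ} (r : ℕ) (hr : 3 ≤ r) (F₀ : SimpleGraph α) (u v : α)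
    (huv : F₀.Adj u v) (hemb : Nonempty (Option α ↪ Fin n))
    (H : Finset (Finset (Fin n))) (hH : ∀ e ∈ H, e.card = r)
    (hF : ¬ HasBergeCopy (subdivideEdge F₀ u v) H) :
    H.card ≤ exClique n r (subdivideEdge F₀ u v) + 8 * exTuran n F₀ +
      exBergeLin r n (subdivideEdge F₀ u v) := by
  obtain ⟨L, hLH, hLlin, hLmax⟩ := exists_maximal_linear H
  have hLb := le_exBergeLin r (subdivideEdge F₀ u v) L (fun e he => hH e (hLH he)) hLlin
    (berge_mono _ hLH hF)
  let Adm1 : Finset (Fin n) → Finset (Fin n) → Prop := fun e π =>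
    ∃ a b c, a ∈ e ∧ b ∈ e ∧ c ∈ e ∧ a ≠ b ∧ a ≠ c ∧ b ≠ c ∧ π = {a, b} ∧ ∃ l ∈ L, a ∈ l ∧ c ∈ l
  let Adm2 : Finset (Fin n) → Finset (Fin n) → Prop := fun e π => π ⊆ e ∧ π.card = 2
  obtain ⟨D1, p1, hD1, hinj1, hadm1, hrest1⟩ := greedy (H \ L) Adm1 ∅
  obtain ⟨D2, p2, hD2, hinj2, hadm2, hrest2⟩ := greedy ((H \ L) \ D1) Adm2 {π | ∃ d ∈ D1, p1 d = π}
  let p : Finset (Fin n) → Finset (Fin n) := fun e => if e ∈ D1 then p1 e else p2 e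
  have hp1 : ∀ e ∈ D1, p e = p1 e := fun e he => if_pos he
  have hp2 : ∀ e ∈ D2, p e = p2 e := fun e he => if_neg (Finset.mem_sdiff.1 (hD2 he)).2
  have hD1H : ∀ e ∈ D1, e ∈ H ∧ e ∉ L := fun e he => Finset.mem_sdiff.1 (hD1 he)
  have hD2H : ∀ e ∈ D2, e ∈ H ∧ e ∉ L := fun e he =>
    Finset.mem_sdiff.1 (Finset.mem_sdiff.1 (hD2 he)).1
  have hD2D1 : ∀ e ∈ D2, e ∉ D1 := fun e he => (Finset.mem_sdiff.1 (hD2 he)).2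
  have hDH : ∀ e ∈ D1 ∪ D2, e ∈ H ∧ e ∉ L := by
    intro e he
    rcases Finset.mem_union.1 he with he | he
    · exact hD1H e he
    · exact hD2H e he
  have hinj : Set.InjOn p (D1 ∪ D2 : Finset (Finset (Fin n))) := by
    intro e he e' he' h
    rcases Finset.mem_union.1 he with k | k <;> rcases Finset.mem_union.1 he' with k' | k'
    · rw [hp1 e k, hp1 e' k'] at h
      exact hinj1 k k' h
    · rw [hp1 e k, hp2 e' k'] at h
      exact absurd ⟨e, k, h⟩ (hadm2 e' k').2
    · rw [hp2 e k, hp1 e' k'] at h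
      exact absurd ⟨e', k', h.symm⟩ (hadm2 e k).2
    · rw [hp2 e k, hp2 e' k'] at h
      exact hinj2 k k' h
  have hpsub : ∀ e ∈ D1 ∪ D2, p e ⊆ e ∧ (p e).card = 2 := by
    intro e he
    rcases Finset.mem_union.1 he with k | k
    · obtain ⟨a, b, c, ha, hb, hc, hab, hac, hbc, h, -⟩ := (hadm1 e k).1
      rw [hp1 e k, h]
      exact ⟨by simp [Finset.insert_subset_iff, ha, hb], Finset.card_pair hab⟩
    · rw [hp2 e k]
      exact (hadm2 e k).1
  -- the clique part
  have hC : ((H \ L) \ (D1 ∪ D2)).card ≤ exClique n r (subdivideEdge F₀ u v) := by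
    apply clique_bound r _ H hF (D1 ∪ D2) (fun e he => (hDH e he).1) p
      (fun e he => (hpsub e he).1)
    · intro e he
      exact hH e (Finset.mem_sdiff.1 (Finset.mem_sdiff.1 he).1).1
    · intro e he π hπ hπ2
      rw [Finset.mem_sdiff, Finset.mem_union, not_or] at he
      rcases hrest2 e (Finset.mem_sdiff.2 ⟨he.1, he.2.1⟩) he.2.2 π ⟨hπ, hπ2⟩ with h | h
      · obtain ⟨d, hd, h⟩ := h
        exact ⟨d, Finset.mem_union_left _ hd, by rw [hp1 d hd, h]⟩
      · obtain ⟨d, hd, h⟩ := h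
        exact ⟨d, Finset.mem_union_right _ hd, by rw [hp2 d hd, h]⟩
  -- witnesses
  have hwit : ∀ e ∈ D1 ∪ D2, ∃ x, x ∉ p e ∧ x ∈ e ∧ ∃ a b, p e = {a, b} ∧ ∃ k ∈ H, k ≠ e ∧
      a ∈ k ∧ x ∈ k ∧ (k ∈ L ∨ (k ∈ D1 ∪ D2 ∧ x ∈ p k)) := by
    intro e he
    rcases Finset.mem_union.1 he with k | k
    · obtain ⟨a, b, c, ha, hb, hc, hab, hac, hbc, h, l, hl, hal, hcl⟩ := (hadm1 e k).1
      refine ⟨c, ?_, hc, a, b, ?_, l, hLH hl, ?_, hal, hcl, Or.inl hl⟩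
      · rw [hp1 e k, h]
        simp [hac.symm, hbc.symm]
      · rw [hp1 e k, h]
      · rintro rfl
        exact (hD1H _ k).2 hl
    · have heD1 := hD2D1 e k
      have hnot : ¬ Adm1 e (p2 e) := by
        intro h
        rcases hrest1 e (Finset.mem_sdiff.2 (hD2H e k)) heD1 _ h with h | h
        · exact h
        · exact (hadm2 e k).2 h
      have hcr : ∀ π, Adm1 e π → ∃ d ∈ D1, p1 d = π := by
        intro π h
        rcases hrest1 e (Finset.mem_sdiff.2 (hD2H e k)) heD1 _ h with h | h
        · exact absurd h (Set.notMem_empty _)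
        · exact h
      have hcr' : ∀ a b, Adm1 e {a, b} → ∃ d ∈ D1 ∪ D2, d ∈ H ∧ d ≠ e ∧ a ∈ d ∧ b ∈ d ∧
          p d = {a, b} := by
        intro a b h
        obtain ⟨d, hd, h⟩ := hcr _ h
        have hdD : d ∈ D1 ∪ D2 := Finset.mem_union_left _ hd
        rw [← hp1 d hd] at h
        have hs := (hpsub d hdD).1
        rw [h] at hs
        exact ⟨d, hdD, (hD1H d hd).1, fun h => heD1 (h ▸ hd), hs (by simp), hs (by simp), h⟩
      obtain ⟨l, hl, hle, hcard⟩ := hLmax e (hD2H e k).1 (hD2H e k).2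
      obtain ⟨x, hx, w, hw, hxw⟩ := Finset.one_lt_card.1 hcard
      rw [Finset.mem_inter] at hx hw
      obtain ⟨a, b, hab, hpe⟩ := Finset.card_eq_two.1 (hadm2 e k).1.2
      have hsub := (hadm2 e k).1.1
      rw [hpe] at hsub
      have ha : a ∈ e := hsub (by simp)
      have hb : b ∈ e := hsub (by simp)
      have hclaim : ∀ a b x w, a ∈ e → b ∈ e → x ∈ e → w ∈ e → a ≠ b → x ≠ w → x ∈ l → w ∈ l →
          p2 e = {a, b} → a = x → ∃ x, x ∉ p e ∧ x ∈ e ∧ ∃ a b, p e = {a, b} ∧ ∃ k ∈ H, k ≠ e ∧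
          a ∈ k ∧ x ∈ k ∧ (k ∈ L ∨ (k ∈ D1 ∪ D2 ∧ x ∈ p k)) := by
        rintro a b x w ha hb hx hw hab hxw hxl hwl hpe rfl
        have hbw : b = w := by
          by_contra hbw
          exact hnot ⟨a, b, w, ha, hb, hw, hab, hxw, hbw, hpe, l, hl, hxl, hwl⟩
        subst hbw
        obtain ⟨y, hy, hy'⟩ : ∃ y ∈ e, y ∉ ({a, b} : Finset (Fin n)) := by
          apply Finset.exists_mem_notMem_of_card_lt_card
          rw [Finset.card_pair hab, hH e (hD2H e k).1]
          omega
        simp only [Finset.mem_insert, Finset.mem_singleton, not_or] at hy'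
        obtain ⟨d, hdD, hdH, hde, had, hyd, hpd⟩ := hcr' a y
          ⟨a, y, b, ha, hy, hb, fun h => hy'.1 h.symm, hab, hy'.2, rfl, l, hl, hxl, hwl⟩
        refine ⟨y, ?_, hy, a, b, by rw [hp2 e k, hpe], d, hdH, hde, had, hyd, Or.inr ⟨hdD, ?_⟩⟩
        · rw [hp2 e k, hpe]
          simp [hy'.1, hy'.2]
        · rw [hpd]; simp
      by_cases hax : a = x
      · exact hclaim a b x w ha hb hx.1 hw.1 hab hxw hx.2 hw.2 hpe hax
      by_cases haw : a = w
      · exact hclaim a b w x ha hb hw.1 hx.1 hab hxw.symm hw.2 hx.2 hpe haw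
      have hpe' : p2 e = {b, a} := by rw [hpe, Finset.pair_comm]
      by_cases hbx : b = x
      · exact hclaim b a x w hb ha hx.1 hw.1 hab.symm hxw hx.2 hw.2 hpe' hbx
      by_cases hbw : b = w
      · exact hclaim b a w x hb ha hw.1 hx.1 hab.symm hxw.symm hw.2 hx.2 hpe' hbw
      obtain ⟨d, hdD, hdH, hde, had, hyd, hpd⟩ := hcr' x a
        ⟨x, a, w, hx.1, ha, hw.1, fun h => hax h.symm, hxw, haw, rfl, l, hl, hx.2, hw.2⟩
      refine ⟨x, ?_, hx.1, a, b, by rw [hp2 e k, hpe], d, hdH, hde, hyd, had, Or.inr ⟨hdD, ?_⟩⟩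
      · rw [hp2 e k, hpe]
        simp [Ne.symm hax, Ne.symm hbx]
      · rw [hpd]; simp
  have : Nonempty (Fin n) := ⟨hemb.some none⟩
  choose! x hxp hxe hwit' using hwit
  let M : Finset (Fin n) → Finset (Finset (Fin n)) := fun A =>
    ((D1 ∪ D2).filter (fun e => p e ⊆ A ∧ x e ∉ A)).image p
  have hMcard : ∀ A, (M A).card ≤ exTuran n F₀ := by
    intro A
    have hmem : ∀ π ∈ M A, ∃ e ∈ D1 ∪ D2, p e ⊆ A ∧ x e ∉ A ∧ p e = π := by
      intro π hπ
      obtain ⟨e, he, h⟩ := Finset.mem_image.1 hπ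
      rw [Finset.mem_filter] at he
      exact ⟨e, he.1, he.2.1, he.2.2, h⟩
    apply turan_bound F₀ u v huv hemb H hF A (M A) (fun π e => e ∈ D1 ∪ D2 ∧ p e = π)
    · intro π hπ
      obtain ⟨e, he, -, -, rfl⟩ := hmem π hπ
      exact (hpsub e he).2
    · intro π hπ
      obtain ⟨e, he, h, -, rfl⟩ := hmem π hπ
      exact h
    · intro π hπ
      obtain ⟨e, he, h, -, rfl⟩ := hmem π hπ
      exact ⟨e, (hDH e he).1, (hpsub e he).1, he, rfl⟩
    · rintro π - π' - e ⟨-, rfl⟩ ⟨-, rfl⟩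
      rfl
    · intro π hπ
      obtain ⟨e, he, h, hxA, rfl⟩ := hmem π hπ
      obtain ⟨a, b, hpe, k, hkH, hke, hak, hxk, hk⟩ := hwit' e he
      refine ⟨x e, hxA, a, b, hpe, k, hkH, e, (hDH e he).1, hke, hak, hxk, hxe e he,
        (hpsub e he).1 (by rw [hpe]; simp), ?_⟩
      intro π' hπ' hne
      constructor
      · rintro ⟨hkD, rfl⟩
        rcases hk with hk | ⟨-, hk⟩
        · exact (hDH k hkD).2 hk
        · obtain ⟨e', -, h', -, heq⟩ := hmem _ hπ'
          rw [heq] at h'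
          exact hxA (h' hk)
      · rintro ⟨-, h⟩
        exact hne h.symm
  obtain ⟨w, hw0, hw1, hw8, -⟩ := exists_weight n
  have havg := averaging w hw0 hw1 M _ hMcard ((D1 ∪ D2).image p) (fun _ => 1 / 8) (by
    intro π hπ
    obtain ⟨e, he, rfl⟩ := Finset.mem_image.1 hπ
    refine (hw8 (p e) (x e) (hpsub e he).2 (hxp e he)).trans ?_
    apply Finset.sum_le_sum_of_subset_of_nonneg
    · intro A hA
      rw [Finset.mem_filter] at hA ⊢
      exact ⟨hA.1, Finset.mem_image_of_mem _ (Finset.mem_filter.2 ⟨he, hA.2⟩)⟩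
    · intro A _ _
      exact hw0 A)
  rw [Finset.sum_const, Finset.card_image_of_injOn hinj, nsmul_eq_mul] at havg
  have hD8 : (D1 ∪ D2).card ≤ 8 * exTuran n F₀ := by
    have : ((D1 ∪ D2).card : ℝ) ≤ 8 * exTuran n F₀ := by linarith
    exact_mod_cast this
  have h1 : (H \ L).card + L.card = H.card := Finset.card_sdiff_add_card_eq_card hLH
  have h2 : ((H \ L) \ (D1 ∪ D2)).card + (D1 ∪ D2).card = (H \ L).card :=
    Finset.card_sdiff_add_card_eq_card (fun e he => Finset.mem_sdiff.2 (hDH e he))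
  omega

lemma third_vertex {n : ℕ} {g π : Finset (Fin n)} (hg : g.card = 3) (hπ : π.card = 2)
    (h : π ⊆ g) : ∃ x, x ∉ π ∧ g = insert x π := by
  obtain ⟨x, hx, hxπ⟩ := Finset.exists_mem_notMem_of_card_lt_card (s := π) (t := g) (by omega)
  refine ⟨x, hxπ, (Finset.eq_of_subset_of_card_le (Finset.insert_subset hx h) ?_).symm⟩
  rw [Finset.card_insert_of_notMem hxπ]
  omega

lemma two_pairs {n : ℕ} {g m κ : Finset (Fin n)} (hg : g.card = 3) (hm : m ⊆ g) (hm2 : m.card = 2)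
    (hκ : κ ⊆ g) (hκ2 : κ.card = 2) (hne : κ ≠ m) :
    ∃ x b c, x ∉ m ∧ g = insert x m ∧ m = {b, c} ∧ κ = {b, x} ∧ b ≠ c := by
  obtain ⟨x, hx, hgx⟩ := third_vertex hg hm2 hm
  have hxκ : x ∈ κ := by
    by_contra hxκ
    apply hne
    apply Finset.eq_of_subset_of_card_le _ (by omega)
    intro y hy
    have := hκ hy
    rw [hgx, Finset.mem_insert] at this
    rcases this with rfl | h
    · exact absurd hy hxκ
    · exact h
  obtain ⟨b, hb, hbx⟩ : ∃ b ∈ κ, b ≠ x := by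
    apply Finset.exists_mem_ne
    omega
  have hbm : b ∈ m := by
    have := hκ hb
    rw [hgx, Finset.mem_insert] at this
    exact this.resolve_left hbx
  obtain ⟨c, hc, hcb⟩ : ∃ c ∈ m, c ≠ b := by
    apply Finset.exists_mem_ne
    omega
  refine ⟨x, b, c, hx, hgx, ?_, ?_, hcb.symm⟩
  · symm
    apply Finset.eq_of_subset_of_card_le
    · simp [Finset.insert_subset_iff, hbm, hc]
    · rw [Finset.card_pair hcb.symm]; omega
  · symm
    apply Finset.eq_of_subset_of_card_le
    · simp [Finset.insert_subset_iff, hb, hxκ]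
    · rw [Finset.card_pair hbx]; omega

lemma three_pairs {n : ℕ} {g π : Finset (Fin n)} (hg : g.card = 3) (hπ : π.card = 2)
    (h : π ⊆ g) : ∃ π₁ π₂, (π₁ ⊆ g ∧ π₁.card = 2) ∧ (π₂ ⊆ g ∧ π₂.card = 2) ∧ π₁ ≠ π ∧ π₂ ≠ π ∧
      π₁ ≠ π₂ ∧ ∀ ρ, ρ ⊆ g → ρ.card = 2 → ρ = π ∨ ρ = π₁ ∨ ρ = π₂ := by
  obtain ⟨x, hx, hgx⟩ := third_vertex hg hπ h
  obtain ⟨b, c, hbc, rfl⟩ := Finset.card_eq_two.1 hπ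
  simp only [Finset.mem_insert, Finset.mem_singleton, not_or] at hx
  have hx1 := hx.1
  have hx2 := hx.2
  have hxb : b ≠ x := Ne.symm hx1
  have hxc : c ≠ x := Ne.symm hx2
  refine ⟨{b, x}, {c, x}, ⟨?_, Finset.card_pair hxb⟩, ⟨?_, Finset.card_pair hxc⟩, ?_, ?_, ?_, ?_⟩
  · rw [hgx]; simp [Finset.insert_subset_iff]
  · rw [hgx]; simp [Finset.insert_subset_iff]
  · intro h
    have : x ∈ ({b, c} : Finset (Fin n)) := by rw [← h]; simp
    simp [hx1, hx2] at this
  · intro h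
    have : x ∈ ({b, c} : Finset (Fin n)) := by rw [← h]; simp
    simp [hx1, hx2] at this
  · intro h
    have : b ∈ ({c, x} : Finset (Fin n)) := by rw [← h]; simp
    simp [hbc, hxb] at this
  · intro ρ hρ hρ2
    by_cases hne : ρ = {b, c}
    · exact Or.inl hne
    · right
      obtain ⟨x', b', c', hx', hgx', hm, hk, hbc'⟩ := two_pairs hg h hπ hρ hρ2 hne
      have hxx : x' = x := by
        have : x' ∈ g := by rw [hgx']; simp
        rw [hgx, Finset.mem_insert] at this
        exact this.resolve_right hx'
      subst hxx
      have : b' ∈ ({b, c} : Finset (Fin n)) := by rw [hm]; simp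
      simp only [Finset.mem_insert, Finset.mem_singleton] at this
      rcases this with rfl | rfl
      · exact Or.inl hk
      · exact Or.inr hk

/-- Pairs lying in at least three hyperedges can be represented by distinct hyperedges. -/
lemma heavy_matching {n : ℕ} (H : Finset (Finset (Fin n))) (hH : ∀ e ∈ H, e.card = 3)
    (heavy : Finset (Fin n) → Prop)
    (hheavy : ∀ π, heavy π ↔ π.card = 2 ∧ 3 ≤ (H.filter (fun e => π ⊆ e)).card) :
    ∃ (D : Finset (Finset (Fin n))) (p : Finset (Fin n) → Finset (Fin n)), D ⊆ H ∧ Set.InjOn p D ∧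
      (∀ e ∈ D, p e ⊆ e ∧ heavy (p e)) ∧ ∀ π, heavy π → ∃ e ∈ D, p e = π := by
  have hall : ∀ s : Finset {π : Finset (Fin n) // heavy π},
      s.card ≤ (s.biUnion (fun π => H.filter (fun e => π.1 ⊆ e))).card := by
    intro s
    have := Finset.card_mul_le_card_mul (s := s)
      (t := s.biUnion (fun π => H.filter (fun e => π.1 ⊆ e))) (m := 3) (n := 3)
      (fun (π : {π : Finset (Fin n) // heavy π}) (e : Finset (Fin n)) => π.1 ⊆ e) (by
        intro π hπ
        refine ((hheavy π.1).1 π.2).2.trans (Finset.card_le_card ?_)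
        intro e he
        rw [Finset.bipartiteAbove, Finset.mem_filter]
        exact ⟨Finset.mem_biUnion.2 ⟨π, hπ, he⟩, (Finset.mem_filter.1 he).2⟩) (by
        intro e he
        obtain ⟨π, hπ, he⟩ := Finset.mem_biUnion.1 he
        have hcard : (e.powersetCard 2).card = 3 := by
          rw [Finset.card_powersetCard, hH e (Finset.mem_filter.1 he).1]; rfl
        rw [← hcard]
        apply Finset.card_le_card_of_injOn (fun π => π.1)
        · intro ρ hρ
          have hρ := (Finset.mem_filter.1 (Finset.mem_coe.1 hρ)).2
          exact Finset.mem_coe.2 (Finset.mem_powersetCard.2 ⟨hρ, ((hheavy ρ.1).1 ρ.2).1⟩)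
        · intro a _ b _ h
          exact Subtype.ext h)
    omega
  obtain ⟨f, hf, hft⟩ := (Finset.all_card_le_biUnion_card_iff_exists_injective _).1 hall
  have hinv : ∀ e ∈ Finset.univ.image f, ∃ π : Finset (Fin n), ∃ h : heavy π, f ⟨π, h⟩ = e := by
    intro e he
    obtain ⟨π, -, h⟩ := Finset.mem_image.1 he
    exact ⟨π.1, π.2, h⟩
  choose! p hp hfp using hinv
  refine ⟨Finset.univ.image f, p, ?_, ?_, ?_, ?_⟩
  · intro e he
    obtain ⟨π, -, rfl⟩ := Finset.mem_image.1 he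
    exact (Finset.mem_filter.1 (hft π)).1
  · intro e he e' he' h
    rw [← hfp e he, ← hfp e' he']
    congr 1
    exact Subtype.ext h
  · intro e he
    refine ⟨?_, hp e he⟩
    have := (Finset.mem_filter.1 (hft ⟨p e, hp e he⟩)).2
    rw [hfp e he] at this
    exact this
  · intro π hπ
    have hm : f ⟨π, hπ⟩ ∈ Finset.univ.image f := Finset.mem_image_of_mem _ (Finset.mem_univ _)
    refine ⟨f ⟨π, hπ⟩, hm, ?_⟩
    have := hf (hfp _ hm)
    exact congrArg Subtype.val this

lemma case_three {α : Type*} {n : ℕ} (F₀ : SimpleGraph α) (u v : α)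
    (huv : F₀.Adj u v) (hemb : Nonempty (Option α ↪ Fin n))
    (H : Finset (Finset (Fin n))) (hH : ∀ e ∈ H, e.card = 3)
    (hF : ¬ HasBergeCopy (subdivideEdge F₀ u v) H) :
    H.card ≤ exClique n 3 (subdivideEdge F₀ u v) + 4 * exTuran n F₀ +
      exBergeLin 3 n (subdivideEdge F₀ u v) := by
  obtain ⟨heavy, hheavy⟩ : ∃ heavy : Finset (Fin n) → Prop,
      ∀ π, heavy π ↔ π.card = 2 ∧ 3 ≤ (H.filter (fun e => π ⊆ e)).card := ⟨_, fun π => Iff.rfl⟩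
  obtain ⟨DQ, pQ, hDQH, hQinj, hQ, hQsurj⟩ := heavy_matching H hH heavy hheavy
  have hheavy2 : ∀ π, heavy π → π.card = 2 := fun π h => ((hheavy π).1 h).1
  let Pr : Finset (Fin n) → Finset (Fin n) → Prop := fun e π => π ⊆ e ∧ π.card = 2
  let C := H.filter (fun e => (∀ π, Pr e π → heavy π) ∨
    (e ∉ DQ ∧ ∀ π π', Pr e π → Pr e π' → ¬ heavy π → ¬ heavy π' → π = π'))
  have hCH : C ⊆ H := Finset.filter_subset _ _
  -- the clique part
  have hC : C.card ≤ exClique n 3 (subdivideEdge F₀ u v) := by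
    obtain ⟨D, p, hDX, -, hadm, hrest⟩ := greedy (C \ DQ) Pr {π | heavy π}
    have hDDQ : ∀ e ∈ D, e ∉ DQ := fun e he => (Finset.mem_sdiff.1 (hDX he)).2
    apply clique_bound 3 _ H hF (DQ ∪ D) _ (fun e => if e ∈ DQ then pQ e else p e)
    · intro e he
      by_cases h : e ∈ DQ
      · simp only [h, if_true]; exact (hQ e h).1
      · simp only [h, if_false]
        exact (hadm e ((Finset.mem_union.1 he).resolve_left h)).1.1
    · exact fun e he => hH e (hCH he)
    · intro e he π hπ hπ2
      by_cases hv : heavy π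
      · obtain ⟨d, hd, h⟩ := hQsurj π hv
        exact ⟨d, Finset.mem_union_left _ hd, by simp [hd, h]⟩
      · have h2 := (Finset.mem_filter.1 he).2
        rcases h2 with h2 | ⟨heQ, h2⟩
        · exact absurd (h2 π ⟨hπ, hπ2⟩) hv
        · by_cases heD : e ∈ D
          · refine ⟨e, Finset.mem_union_right _ heD, ?_⟩
            simp only [heQ, if_false]
            exact h2 _ _ (hadm e heD).1 ⟨hπ, hπ2⟩ (hadm e heD).2 hv
          · rcases hrest e (Finset.mem_sdiff.2 ⟨he, heQ⟩) heD π ⟨hπ, hπ2⟩ with h | ⟨d, hd, h⟩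
            · exact absurd h hv
            · exact ⟨d, Finset.mem_union_right _ hd, by simp [hDDQ d hd, h]⟩
    · intro e he
      rcases Finset.mem_union.1 he with h | h
      · exact hDQH h
      · exact hCH (Finset.mem_sdiff.1 (hDX h)).1
  obtain ⟨L, hLX, hLlin, hLmax⟩ := exists_maximal_linear (H \ C)
  have hLH : L ⊆ H := fun e he => (Finset.mem_sdiff.1 (hLX he)).1
  have hLb := le_exBergeLin 3 (subdivideEdge F₀ u v) L (fun e he => hH e (hLH he)) hLlin
    (berge_mono _ hLH hF)
  have hLpair : ∀ e ∈ H, e ∉ C → e ∉ L → ∃ σ, Pr e σ ∧ ∃ l ∈ L, l ≠ e ∧ σ ⊆ l := by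
    intro e he heC heL
    obtain ⟨l, hl, hle, hc⟩ := hLmax e (Finset.mem_sdiff.2 ⟨he, heC⟩) heL
    obtain ⟨σ, hσ, hσ2⟩ := Finset.exists_subset_card_eq hc
    exact ⟨σ, ⟨hσ.trans Finset.inter_subset_left, hσ2⟩, l, hl, hle,
      hσ.trans Finset.inter_subset_right⟩
  let NoL : Finset (Fin n) → Prop := fun κ => ∀ l ∈ L, ¬ κ ⊆ l
  let Good : Finset (Fin n) → Finset (Fin n) → Prop := fun e κ => Pr e κ ∧ ∃ k ∈ H, k ≠ e ∧ κ ⊆ k ∧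
    (k ∈ L ∨ (k ∈ DQ ∧ pQ k = κ ∧ NoL κ))
  let HT : Finset (Fin n) → Prop := fun e => e ∈ (H \ C) \ L ∧ (e ∈ DQ ∧ NoL (pQ e))
  let LT : Finset (Fin n) → Prop := fun e => e ∈ (H \ C) \ L ∧ ¬ (e ∈ DQ ∧ NoL (pQ e))
  have hR : ∀ e ∈ (H \ C) \ L, e ∈ H ∧ e ∉ C ∧ e ∉ L := by
    intro e he
    rw [Finset.mem_sdiff, Finset.mem_sdiff] at he
    exact ⟨he.1.1, he.1.2, he.2⟩
  have hgoodL : ∀ e κ, e ∉ L → Pr e κ → ¬ NoL κ → Good e κ := by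
    intro e κ heL hκ hno
    simp only [NoL, not_forall, not_not] at hno
    obtain ⟨l, hl, hκl⟩ := hno
    exact ⟨hκ, l, hLH hl, fun h => heL (h ▸ hl), hκl, Or.inl hl⟩
  have hgoodH : ∀ e κ, e ∉ L → Pr e κ → heavy κ → ¬ (e ∈ DQ ∧ pQ e = κ) → Good e κ := by
    intro e κ heL hκ hv hn
    by_cases hno : NoL κ
    · obtain ⟨k, hk, hpk⟩ := hQsurj κ hv
      refine ⟨hκ, k, hDQH hk, ?_, ?_, Or.inr ⟨hk, hpk, hno⟩⟩
      · rintro rfl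
        exact hn ⟨hk, hpk⟩
      · rw [← hpk]; exact (hQ k hk).1
    · exact hgoodL e κ heL hκ hno
  let Main : Finset (Fin n) → Finset (Fin n) → Prop := fun e m => Pr e m ∧
    (∃ κ, κ ≠ m ∧ Good e κ) ∧ (heavy m → (e ∈ DQ ∧ pQ e = m))
  have hmains : ∀ e, LT e → ∃ m₁ m₂, m₁ ≠ m₂ ∧ Main e m₁ ∧ Main e m₂ := by
    rintro e ⟨heR, hnot⟩
    obtain ⟨heH, heC, heL⟩ := hR e heR
    have heC' : ¬ ((∀ π, Pr e π → heavy π) ∨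
      (e ∉ DQ ∧ ∀ π π', Pr e π → Pr e π' → ¬ heavy π → ¬ heavy π' → π = π')) :=
      fun h => heC (Finset.mem_filter.2 ⟨heH, h⟩)
    rw [not_or] at heC'
    by_cases heQ : e ∈ DQ
    · have hqv := (hQ e heQ).2
      have hqP : Pr e (pQ e) := ⟨(hQ e heQ).1, hheavy2 _ hqv⟩
      have hno : ¬ NoL (pQ e) := fun h => hnot ⟨heQ, h⟩
      have hqG := hgoodL e _ heL hqP hno
      obtain ⟨π₁, π₂, hP1, hP2, hne1, hne2, hne, hcov⟩ := three_pairs (hH e heH) hqP.2 hqP.1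
      have hclaim : ∀ lam o, Pr e lam → Pr e o → lam ≠ pQ e → o ≠ pQ e → lam ≠ o → ¬ heavy lam →
          ∃ m₁ m₂, m₁ ≠ m₂ ∧ Main e m₁ ∧ Main e m₂ := by
        intro lam o hPl hPo hl ho hlo hlv
        have hml : Main e lam := ⟨hPl, ⟨pQ e, hl.symm, hqG⟩, fun h => absurd h hlv⟩
        by_cases hov : heavy o
        · exact ⟨lam, pQ e, hl, hml, hqP, ⟨o, ho, hgoodH e o heL hPo hov (fun h => ho h.2.symm)⟩,
            fun _ => ⟨heQ, rfl⟩⟩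
        · exact ⟨lam, o, hlo, hml, hPo, ⟨pQ e, ho.symm, hqG⟩, fun h => absurd h hov⟩
      obtain ⟨lam, hlam⟩ := not_forall.1 heC'.1
      rw [Classical.not_imp] at hlam
      rcases hcov lam hlam.1.1 hlam.1.2 with h | h | h
      · exact absurd (h ▸ hqv) hlam.2
      · exact hclaim π₁ π₂ hP1 hP2 hne1 hne2 hne (h ▸ hlam.2)
      · exact hclaim π₂ π₁ hP2 hP1 hne2 hne1 hne.symm (h ▸ hlam.2)
    · by_cases hex : ∃ o, Pr e o ∧ heavy o
      · obtain ⟨o, hPo, hov⟩ := hex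
        have hG := hgoodH e o heL hPo hov (fun h => heQ h.1)
        have h2 : ¬ ∀ π π', Pr e π → Pr e π' → ¬ heavy π → ¬ heavy π' → π = π' :=
          fun h => heC'.2 ⟨heQ, h⟩
        push Not at h2
        obtain ⟨m₁, m₂, hP1, hP2, hv1, hv2, hne⟩ := h2
        refine ⟨m₁, m₂, hne, ⟨hP1, ⟨o, ?_, hG⟩, fun h => absurd h hv1⟩,
          ⟨hP2, ⟨o, ?_, hG⟩, fun h => absurd h hv2⟩⟩
        · rintro rfl; exact hv1 hov
        · rintro rfl; exact hv2 hov
      · obtain ⟨σ, hσ, l, hl, hle, hσl⟩ := hLpair e heH heC heL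
        have hG : Good e σ := ⟨hσ, l, hLH hl, hle, hσl, Or.inl hl⟩
        obtain ⟨π₁, π₂, hP1, hP2, hne1, hne2, hne, -⟩ := three_pairs (hH e heH) hσ.2 hσ.1
        exact ⟨π₁, π₂, hne, ⟨hP1, ⟨σ, hne1.symm, hG⟩, fun h => absurd ⟨_, hP1, h⟩ hex⟩,
          ⟨hP2, ⟨σ, hne2.symm, hG⟩, fun h => absurd ⟨_, hP2, h⟩ hex⟩⟩
  have hlab : ∀ e, HT e → ∀ g ∈ H, pQ e ⊆ g → ∃ κ, κ ≠ pQ e ∧ Good g κ := by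
    rintro e ⟨heR, heQ, hno⟩ g hg hsub
    have hgL : g ∉ L := fun h => hno g h hsub
    have hq2 := hheavy2 _ (hQ e heQ).2
    by_cases hgC : g ∈ C
    · obtain ⟨π₁, π₂, hP1, hP2, hne1, hne2, hne, -⟩ := three_pairs (hH g hg) hq2 hsub
      rcases (Finset.mem_filter.1 hgC).2 with h | ⟨hgQ, h⟩
      · by_cases h1 : g ∈ DQ ∧ pQ g = π₁
        · refine ⟨π₂, hne2, hgoodH g π₂ hgL hP2 (h _ hP2) ?_⟩
          rintro ⟨-, h2⟩
          exact hne (h1.2.symm.trans h2)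
        · exact ⟨π₁, hne1, hgoodH g π₁ hgL hP1 (h _ hP1) h1⟩
      · by_cases h1 : heavy π₁
        · exact ⟨π₁, hne1, hgoodH g π₁ hgL hP1 h1 (fun k => hgQ k.1)⟩
        · refine ⟨π₂, hne2, hgoodH g π₂ hgL hP2 ?_ (fun k => hgQ k.1)⟩
          by_contra h2
          exact hne (h _ _ hP1 hP2 h1 h2)
    · obtain ⟨σ, hσ, l, hl, hle, hσl⟩ := hLpair g hg hgC hgL
      refine ⟨σ, ?_, hσ, l, hLH hl, hle, hσl, Or.inl hl⟩
      rintro rfl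
      exact hno l hl hσl
  let M : Finset (Fin n) → Finset (Finset (Fin n)) := fun A => Finset.univ.filter (fun π =>
    (∃ e, HT e ∧ pQ e = π ∧ π ⊆ A ∧ ∃ g ∈ H, π ⊆ g ∧ ¬ g ⊆ A) ∨
    (∃ e, LT e ∧ Main e π ∧ e ∩ A = π))
  have hMcard : ∀ A, (M A).card ≤ exTuran n F₀ := by
    intro A
    have hmem : ∀ π ∈ M A, (∃ e, HT e ∧ pQ e = π ∧ π ⊆ A ∧ ∃ g ∈ H, π ⊆ g ∧ ¬ g ⊆ A) ∨
        (∃ e, LT e ∧ Main e π ∧ e ∩ A = π) := fun π hπ => (Finset.mem_filter.1 hπ).2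
    have hM2 : ∀ π ∈ M A, π.card = 2 := by
      intro π hπ
      rcases hmem π hπ with ⟨e, he, rfl, -⟩ | ⟨e, -, hm, -⟩
      · exact hheavy2 _ (hQ e he.2.1).2
      · exact hm.1.2
    have hMA : ∀ π ∈ M A, π ⊆ A := by
      intro π hπ
      rcases hmem π hπ with ⟨e, he, rfl, h, -⟩ | ⟨e, -, hm, h⟩
      · exact h
      · rw [← h]; exact Finset.inter_subset_right
    apply turan_bound F₀ u v huv hemb H hF A (M A)
      (fun π e => (HT e ∧ pQ e = π) ∨ (LT e ∧ Main e π ∧ e ∩ A = π)) hM2 hMA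
    · intro π hπ
      rcases hmem π hπ with ⟨e, he, h1, h, -⟩ | ⟨e, he, hm, h⟩
      · exact ⟨e, (hR e he.1).1, h1 ▸ (hQ e he.2.1).1, Or.inl ⟨he, h1⟩⟩
      · exact ⟨e, (hR e he.1).1, hm.1.1, Or.inr ⟨he, hm, h⟩⟩
    · rintro π - π' - e (⟨h1, rfl⟩ | ⟨h1, -, rfl⟩) (⟨h2, rfl⟩ | ⟨h2, -, rfl⟩)
      · rfl
      · exact absurd h1.2 h2.2
      · exact absurd h2.2 h1.2
      · rfl
    · intro π hπ
      obtain ⟨g, hg, hπg, hgA, κ, hκne, hκP, k, hkH, hkg, hκk, hk⟩ : ∃ g ∈ H, π ⊆ g ∧ ¬ g ⊆ A ∧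
          ∃ κ, κ ≠ π ∧ Good g κ := by
        rcases hmem π hπ with ⟨e, he, rfl, -, g, hg, h1, h2⟩ | ⟨e, he, hm, h⟩
        · exact ⟨g, hg, h1, h2, hlab e he g hg h1⟩
        · refine ⟨e, (hR e he.1).1, hm.1.1, ?_, hm.2.1⟩
          intro hs
          rw [Finset.inter_eq_left.2 hs] at h
          have h3 := hH e (hR e he.1).1
          have h2 := hm.1.2
          rw [h] at h3
          omega
      obtain ⟨x, b, c, hx, hgx, hm, hκ, hbc⟩ :=
        two_pairs (hH g hg) hπg (hM2 π hπ) hκP.1 hκP.2 hκne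
      have hxA : x ∉ A := by
        intro hxA
        apply hgA
        rw [hgx]
        exact Finset.insert_subset hxA (hMA π hπ)
      refine ⟨x, hxA, b, c, hm, k, hkH, g, hg, hkg, hκk (by rw [hκ]; simp),
        hκk (by rw [hκ]; simp), by rw [hgx]; simp, hπg (by rw [hm]; simp), ?_⟩
      intro π' hπ' hne
      constructor
      · intro hrep
        rcases hk with hk | ⟨hkQ, hpk, hno⟩
        · rcases hrep with ⟨h, -⟩ | ⟨h, -⟩
          · exact (hR k h.1).2.2 hk
          · exact (hR k h.1).2.2 hk
        · rcases hrep with ⟨h, h'⟩ | ⟨h, -⟩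
          · apply hxA
            apply hMA π' hπ'
            rw [← h', hpk, hκ]; simp
          · exact h.2 ⟨hkQ, by rw [hpk]; exact hno⟩
      · intro hrep
        apply hne
        have hsub : π' ⊆ g := by
          rcases hrep with ⟨h, rfl⟩ | ⟨h, h', -⟩
          · exact (hQ g h.2.1).1
          · exact h'.1.1
        apply Finset.eq_of_subset_of_card_le
        · intro y hy
          have h1 := hsub hy
          rw [hgx, Finset.mem_insert] at h1
          rcases h1 with rfl | h1
          · exact absurd (hMA π' hπ' hy) hxA
          · exact h1
        · rw [hM2 π hπ, hM2 π' hπ']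
  obtain ⟨w, hw0, hw1, hw8, hw4⟩ := exists_weight n
  let N : Finset (Fin n) → Finset (Finset (Fin n)) := fun π =>
    Finset.univ.filter (fun e => LT e ∧ Main e π)
  let K : Finset (Fin n) → Finset (Finset (Fin n)) := fun π =>
    Finset.univ.filter (fun e => HT e ∧ pQ e = π)
  have hK1 : ∀ π, (K π).card ≤ 1 := by
    intro π
    rw [Finset.card_le_one]
    intro a ha b hb
    have ha := (Finset.mem_filter.1 ha).2
    have hb := (Finset.mem_filter.1 hb).2
    exact hQinj ha.1.2.1 hb.1.2.1 (ha.2.trans hb.2.symm)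
  have hN2 : ∀ π, (N π).card ≤ 2 := by
    intro π
    by_cases hv : heavy π
    · have : (N π).card ≤ 1 := by
        rw [Finset.card_le_one]
        intro a ha b hb
        have ha := (Finset.mem_filter.1 ha).2.2.2.2 hv
        have hb := (Finset.mem_filter.1 hb).2.2.2.2 hv
        exact hQinj ha.1 hb.1 (ha.2.trans hb.2.symm)
      omega
    · rcases Finset.eq_empty_or_nonempty (N π) with h | ⟨e, he⟩
      · rw [h]; simp
      · have hπ2 := (Finset.mem_filter.1 he).2.2.1.2
        have hd : ¬ 3 ≤ (H.filter (fun e => π ⊆ e)).card := fun h => hv ((hheavy π).2 ⟨hπ2, h⟩)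
        have : (N π).card ≤ (H.filter (fun e => π ⊆ e)).card := by
          apply Finset.card_le_card
          intro e he
          have := (Finset.mem_filter.1 he).2
          exact Finset.mem_filter.2 ⟨(hR e this.1.1).1, this.2.1.1⟩
        omega
  have hNK : ∀ π, (K π).Nonempty → N π = ∅ := by
    rintro π ⟨e, he⟩
    have he := (Finset.mem_filter.1 he).2
    rw [Finset.eq_empty_iff_forall_notMem]
    intro e' he'
    have he' := (Finset.mem_filter.1 he').2
    have hv : heavy π := he.2 ▸ (hQ e he.1.2.1).2
    have h := he'.2.2.2 hv
    have : e' = e := hQinj h.1 he.1.2.1 (h.2.trans he.2.symm)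
    subst this
    exact he'.1.2 he.1.2
  have hthird : ∀ (π A e : Finset (Fin n)) (x : Fin n), x ∉ A → π ⊆ A → e = insert x π →
      e ∩ A = π := by
    rintro π A e x hx hπ rfl
    rw [Finset.insert_inter_of_notMem hx]
    exact Finset.inter_eq_left.2 hπ
  have havg := averaging w hw0 hw1 M _ hMcard Finset.univ
    (fun π => ((N π).card : ℝ) / 8 + ((K π).card : ℝ) / 4) (by
    intro π _
    have hmono : ∀ (P : Finset (Fin n) → Prop) [DecidablePred P], (∀ A, P A → π ∈ M A) →
        ∑ A : Finset (Fin n) with P A, w A ≤ ∑ A : Finset (Fin n) with π ∈ M A, w A := by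
      intro P _ hP
      apply Finset.sum_le_sum_of_subset_of_nonneg
      · intro A hA
        rw [Finset.mem_filter] at hA ⊢
        exact ⟨hA.1, hP A hA.2⟩
      · intro A _ _
        exact hw0 A
    rcases Finset.eq_empty_or_nonempty (K π) with hK | hK
    · have hcase : (N π).card = 0 ∨ (N π).card = 1 ∨ (N π).card = 2 := by
        have := hN2 π
        omega
      rw [hK]
      rcases hcase with h | h | h
      · rw [h]
        simp only [Finset.card_empty, Nat.cast_zero, zero_div, add_zero]
        exact Finset.sum_nonneg (fun A _ => hw0 A)
      · obtain ⟨e, he⟩ := Finset.card_eq_one.1 h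
        have heN : e ∈ N π := by rw [he]; simp
        have heN := (Finset.mem_filter.1 heN).2
        obtain ⟨x, hx, hex⟩ := third_vertex (hH e (hR e heN.1.1).1) heN.2.1.2 heN.2.1.1
        have h1 := hw8 π x heN.2.1.2 hx
        have h2 := hmono (fun A => π ⊆ A ∧ x ∉ A) (by
          rintro A ⟨hA, hxA⟩
          exact Finset.mem_filter.2 ⟨Finset.mem_univ _, Or.inr ⟨e, heN.1, heN.2,
            hthird π A e x hxA hA hex⟩⟩)
        rw [h]
        simp only [Finset.card_empty, Nat.cast_zero, zero_div, add_zero, Nat.cast_one]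
        exact h1.trans h2
      · obtain ⟨e, e', hne, he⟩ := Finset.card_eq_two.1 h
        have heN : e ∈ N π := by rw [he]; simp
        have heN' : e' ∈ N π := by rw [he]; simp
        have heN := (Finset.mem_filter.1 heN).2
        have heN' := (Finset.mem_filter.1 heN').2
        obtain ⟨x, hx, hex⟩ := third_vertex (hH e (hR e heN.1.1).1) heN.2.1.2 heN.2.1.1
        obtain ⟨y, hy, hey⟩ := third_vertex (hH e' (hR e' heN'.1.1).1) heN'.2.1.2 heN'.2.1.1
        have hxy : x ≠ y := by
          rintro rfl
          exact hne (hex.trans hey.symm)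
        have h1 := hw4 π x y heN.2.1.2 hx hy hxy
        have h2 := hmono (fun A => π ⊆ A ∧ (x ∉ A ∨ y ∉ A)) (by
          rintro A ⟨hA, hxA | hxA⟩
          · exact Finset.mem_filter.2 ⟨Finset.mem_univ _, Or.inr ⟨e, heN.1, heN.2,
              hthird π A e x hxA hA hex⟩⟩
          · exact Finset.mem_filter.2 ⟨Finset.mem_univ _, Or.inr ⟨e', heN'.1, heN'.2,
              hthird π A e' y hxA hA hey⟩⟩)
        rw [h]
        simp only [Finset.card_empty, Nat.cast_zero, zero_div, add_zero]
        refine le_trans ?_ (h1.trans h2)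
        norm_num
    · have hK1' : (K π).card = 1 := le_antisymm (hK1 π) (Finset.card_pos.2 hK)
      rw [hNK π hK, hK1']
      obtain ⟨e, he⟩ := hK
      have he := (Finset.mem_filter.1 he).2
      have hv : heavy π := he.2 ▸ (hQ e he.1.2.1).2
      have hdeg := ((hheavy π).1 hv).2
      have hπ2 := hheavy2 π hv
      obtain ⟨g, hg, g', hg', hne⟩ := Finset.one_lt_card.1 (show 1 < (H.filter (fun e => π ⊆ e)).card by omega)
      rw [Finset.mem_filter] at hg hg'
      obtain ⟨x, hx, hex⟩ := third_vertex (hH g hg.1) hπ2 hg.2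
      obtain ⟨y, hy, hey⟩ := third_vertex (hH g' hg'.1) hπ2 hg'.2
      have hxy : x ≠ y := by
        rintro rfl
        exact hne (hex.trans hey.symm)
      have h1 := hw4 π x y hπ2 hx hy hxy
      have h2 := hmono (fun A => π ⊆ A ∧ (x ∉ A ∨ y ∉ A)) (by
        rintro A ⟨hA, hxA | hxA⟩
        · refine Finset.mem_filter.2 ⟨Finset.mem_univ _, Or.inl ⟨e, he.1, he.2, hA, g, hg.1, hg.2,
            fun h => hxA (h ?_)⟩⟩
          rw [hex]; simp
        · refine Finset.mem_filter.2 ⟨Finset.mem_univ _, Or.inl ⟨e, he.1, he.2, hA, g', hg'.1,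
            hg'.2, fun h => hxA (h ?_)⟩⟩
          rw [hey]; simp)
      refine le_trans ?_ (h1.trans h2)
      norm_num)
  -- counting
  let RL := ((H \ C) \ L).filter (fun e => ¬ (e ∈ DQ ∧ NoL (pQ e)))
  let RH := ((H \ C) \ L).filter (fun e => e ∈ DQ ∧ NoL (pQ e))
  have hcount : RH.card + RL.card = ((H \ C) \ L).card :=
    Finset.card_filter_add_card_filter_not _
  have hsumN : 2 * RL.card ≤ ∑ π, (N π).card := by
    have h1 : ∑ π, (N π).card = ∑ e, (Finset.univ.filter (fun π => LT e ∧ Main e π)).card := by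
      simp only [N, Finset.card_filter]
      rw [Finset.sum_comm]
      refine Finset.sum_congr rfl (fun e _ => Finset.sum_congr rfl (fun π _ => ?_))
      congr
    rw [h1, mul_comm, ← smul_eq_mul, ← Finset.sum_const]
    refine le_trans ?_ (Finset.sum_le_univ_sum_of_nonneg (s := RL) (fun _ => Nat.zero_le _))
    apply Finset.sum_le_sum
    intro e he
    have heL : LT e := Finset.mem_filter.1 he
    obtain ⟨m₁, m₂, hne, h1, h2⟩ := hmains e heL
    exact Finset.one_lt_card.2 ⟨m₁, Finset.mem_filter.2 ⟨Finset.mem_univ _, heL, h1⟩,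
      m₂, Finset.mem_filter.2 ⟨Finset.mem_univ _, heL, h2⟩, hne⟩
  have hsumK : RH.card ≤ ∑ π, (K π).card := by
    have h1 : ∑ π, (K π).card = ∑ e, (Finset.univ.filter (fun π => HT e ∧ pQ e = π)).card := by
      simp only [K, Finset.card_filter]
      exact Finset.sum_comm
    rw [h1, Finset.card_eq_sum_ones]
    refine le_trans ?_ (Finset.sum_le_univ_sum_of_nonneg (s := RH) (fun _ => Nat.zero_le _))
    apply Finset.sum_le_sum
    intro e he
    have heH : HT e := Finset.mem_filter.1 he
    exact Finset.card_pos.2 ⟨pQ e, Finset.mem_filter.2 ⟨Finset.mem_univ _, heH, rfl⟩⟩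
  rw [Finset.sum_add_distrib, ← Finset.sum_div, ← Finset.sum_div, ← Nat.cast_sum,
    ← Nat.cast_sum] at havg
  have hR4 : ((H \ C) \ L).card ≤ 4 * exTuran n F₀ := by
    have h1 : (2 * (RL.card : ℝ)) ≤ ((∑ π, (N π).card : ℕ) : ℝ) := by exact_mod_cast hsumN
    have h2 : (RH.card : ℝ) ≤ ((∑ π, (K π).card : ℕ) : ℝ) := by exact_mod_cast hsumK
    have h3 : (RH.card : ℝ) + RL.card = ((H \ C) \ L).card := by exact_mod_cast hcount
    have : (((H \ C) \ L).card : ℝ) ≤ 4 * exTuran n F₀ := by linarith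
    exact_mod_cast this
  have h1 : (H \ C).card + C.card = H.card := Finset.card_sdiff_add_card_eq_card hCH
  have h2 : ((H \ C) \ L).card + L.card = (H \ C).card := Finset.card_sdiff_add_card_eq_card hLX
  omega


/-- If `r ≥ 2` and `F` is obtained from `F₀` by subdividing an edge, then
`ex_r(n, Berge-F) ≤ ex(n, K_r, F) + 2^(r-1) · ex(n, F₀) + ex_r^lin(n, Berge-F)`. -/
theorem berge_upper_bound {α : Type*} (r : ℕ) (hr : 2 ≤ r)
    (F₀ : SimpleGraph α) (u v : α) (huv : F₀.Adj u v) (n : ℕ) :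
    exBerge r n (subdivideEdge F₀ u v) ≤
      exClique n r (subdivideEdge F₀ u v) + 2 ^ (r - 1) * exTuran n F₀ +
        exBergeLin r n (subdivideEdge F₀ u v) := by
  apply csSup_le'
  rintro m ⟨H, hH, hF, rfl⟩
  by_cases hemb : Nonempty (Option α ↪ Fin n)
  · rcases Nat.lt_or_ge r 3 with h2 | h3
    · have hlin : IsLinear H := by
        intro e₁ h₁ e₂ h₂ hne
        by_contra hcon
        have c1 := hH e₁ h₁
        have c2 := hH e₂ h₂
        apply hne
        have e1 : e₁ ∩ e₂ = e₁ :=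
          Finset.eq_of_subset_of_card_le Finset.inter_subset_left (by omega)
        have e2 : e₁ ∩ e₂ = e₂ :=
          Finset.eq_of_subset_of_card_le Finset.inter_subset_right (by omega)
        rw [← e1, e2]
      have := le_exBergeLin r _ H hH hlin hF
      omega
    · rcases Nat.lt_or_ge r 4 with h4 | h4
      · have hr3 : r = 3 := by omega
        subst hr3
        have := case_three F₀ u v huv hemb H hH hF
        simpa using this
      · have h := case_general r h3 F₀ u v huv hemb H hH hF
        have hpow : 2 ^ 3 ≤ 2 ^ (r - 1) := Nat.pow_le_pow_right (by norm_num) (by omega)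
        have hmul : 8 * exTuran n F₀ ≤ 2 ^ (r - 1) * exTuran n F₀ :=
          Nat.mul_le_mul_right _ hpow
        omega
  · have hfree : ¬ HasCopy (subdivideEdge F₀ u v) (⊤ : SimpleGraph (Fin n)) := by
      rintro ⟨φ, -⟩
      exact hemb ⟨φ⟩
    have h1 := le_exClique r _ _ hfree
    have h2 : H.card ≤ cliqueCount r (⊤ : SimpleGraph (Fin n)) := by
      rw [← Set.ncard_coe_finset, cliqueCount]
      apply Set.ncard_le_ncard _ (Set.toFinite _)
      intro e he
      exact ⟨fun a _ b _ hab => hab, hH e he⟩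
    omega
end

section
/- For every integer k > 1 and every n, the maximum number of hyperedges in a 3-uniform Berge-C_{2k+1}-free hypergraph on n vertices satisfies ex_3(n, Berge-C_{2k+1}) ≤ ((16k−16)/3) · ex(⌈n/2⌉, C_{2k}) + ex_3^{lin}(n, Berge-C_{2k+1}). -/
open scoped Classical

/-! ### Paths in graphs given by sets of pairs -/

section Paths

variable {V : Type*}

/-- Opening up a cycle (given as a list) at the vertex `x`. -/
lemma chain_rotate {R : V → V → Prop} {s t : List V} {x : V}
    (hc : List.IsChain R (s ++ x :: t))
    (hclose : ∀ a ∈ (s ++ x :: t).getLast?, ∀ b ∈ (s ++ x :: t).head?, R a b) :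
    List.IsChain R (t ++ (s ++ [x])) := by
  rw [List.isChain_append] at hc
  obtain ⟨h1, h2, h3⟩ := hc
  rw [List.isChain_cons] at h2
  refine List.isChain_append.2 ⟨h2.2, List.isChain_append.2 ⟨h1, by simp, ?_⟩, ?_⟩
  · intro a ha b hb
    apply h3 a ha b
    simpa using hb
  · intro a ha b hb
    apply hclose a ?_ b ?_
    · rw [List.getLast?_append, List.getLast?_cons]
      simp at ha ⊢
      simp [ha]
    · cases s <;> simpa using hb

/-- Crossing argument: a longest path with large end degrees closes up to a cycle. -/
lemma exists_cross [DecidableEq V] {R : V → V → Prop} (hsymm : ∀ a b, R a b → R b a) {l : List V} (k : ℕ)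
    (hnd : l.Nodup) (hch : List.IsChain R l) (hne : l ≠ []) (hlen : l.length < 2 * k)
    (N0 N1 : Finset V) (h0 : k ≤ N0.card) (h1 : k ≤ N1.card)
    (hN0 : ∀ u ∈ N0, u ∈ l ∧ u ≠ l.head hne ∧ R (l.head hne) u)
    (hN1 : ∀ u ∈ N1, u ∈ l ∧ u ≠ l.getLast hne ∧ R (l.getLast hne) u) :
    ∃ c : List V, c.Perm l ∧ List.IsChain R c ∧
      ∀ a ∈ c.getLast?, ∀ b ∈ c.head?, R a b := by
  set N := l.length with hN
  have hNpos : 0 < N := List.length_pos_iff.2 hne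
  set I := (Finset.range (N - 1)).filter (fun i => ∃ h : i + 1 < N, l[i + 1] ∈ N0) with hI
  set J := (Finset.range (N - 1)).filter (fun i => ∃ h : i < N, l[i] ∈ N1) with hJ
  have cI : k ≤ I.card := by
    refine h0.trans ?_
    have : N0 ⊆ I.image (fun i => if h : i + 1 < N then l[i + 1] else l.head hne) := by
      intro u hu
      obtain ⟨hul, hu0, _⟩ := hN0 u hu
      obtain ⟨j, hj, rfl⟩ := List.mem_iff_getElem.1 hul
      have hj0 : j ≠ 0 := by
        rintro rfl
        apply hu0
        rw [List.head_eq_getElem]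
      obtain ⟨i, rfl⟩ := Nat.exists_eq_succ_of_ne_zero hj0
      refine Finset.mem_image.2 ⟨i, ?_, ?_⟩
      · simp only [hI, Finset.mem_filter, Finset.mem_range]
        exact ⟨by omega, hj, hu⟩
      · simp only [Nat.succ_eq_add_one] at *
        rw [dif_pos hj]
    exact (Finset.card_le_card this).trans Finset.card_image_le
  have cJ : k ≤ J.card := by
    refine h1.trans ?_
    have : N1 ⊆ J.image (fun i => if h : i < N then l[i] else l.head hne) := by
      intro u hu
      obtain ⟨hul, hu0, _⟩ := hN1 u hu
      obtain ⟨j, hj, rfl⟩ := List.mem_iff_getElem.1 hul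
      have hj0 : j ≠ N - 1 := by
        rintro rfl
        apply hu0
        rw [List.getLast_eq_getElem]
      refine Finset.mem_image.2 ⟨j, ?_, ?_⟩
      · simp only [hJ, Finset.mem_filter, Finset.mem_range]
        exact ⟨by omega, hj, hu⟩
      · rw [dif_pos hj]
    exact (Finset.card_le_card this).trans Finset.card_image_le
  have hinter : ∃ i, i ∈ I ∧ i ∈ J := by
    by_contra hcon
    push Not at hcon
    have hd : Disjoint I J := Finset.disjoint_left.2 hcon
    have hsub : I ∪ J ⊆ Finset.range (N - 1) :=
      Finset.union_subset (Finset.filter_subset _ _) (Finset.filter_subset _ _)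
    have := Finset.card_le_card hsub
    rw [Finset.card_union_of_disjoint hd, Finset.card_range] at this
    omega
  obtain ⟨i, hiI, hiJ⟩ := hinter
  simp only [hI, Finset.mem_filter, Finset.mem_range] at hiI
  simp only [hJ, Finset.mem_filter, Finset.mem_range] at hiJ
  obtain ⟨_, hi1, hi0⟩ := hiI
  obtain ⟨_, hi2, hi3⟩ := hiJ
  have r0 := (hN0 _ hi0).2.2
  have r1 := (hN1 _ hi3).2.2
  have hsplit : l.take (i + 1) ++ l.drop (i + 1) = l := List.take_append_drop _ _
  have hch' := hch
  rw [← hsplit, List.isChain_append] at hch'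
  obtain ⟨c1, c2, _⟩ := hch'
  have hdne : l.drop (i + 1) ≠ [] := by
    rw [Ne, List.drop_eq_nil_iff]; omega
  refine ⟨l.take (i + 1) ++ (l.drop (i + 1)).reverse, ?_, ?_, ?_⟩
  · conv_rhs => rw [← hsplit]
    exact (List.reverse_perm _).append_left _
  · refine List.isChain_append.2 ⟨c1, ?_, ?_⟩
    · rw [List.isChain_reverse]
      exact c2.imp (fun a b h => hsymm _ _ h)
    · intro a ha b hb
      rw [List.head?_reverse, List.getLast?_drop, if_neg (by omega),
        List.getLast?_eq_getLast_of_ne_nil hne] at hb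
      rw [List.getLast?_take, if_neg (by omega)] at ha
      simp at ha hb
      rw [List.getElem?_eq_getElem (by omega)] at ha
      simp at ha
      rcases ha with ha | ha
      · subst ha hb
        exact hsymm _ _ r1
      · omega
  · intro a ha b hb
    rw [List.getLast?_append, List.getLast?_reverse, List.head?_drop,
      List.getElem?_eq_getElem hi1] at ha
    rw [List.head?_append, List.head?_take, if_neg (by omega),
      List.head?_eq_some_head hne] at hb
    simp at ha hb
    subst ha hb
    exact hsymm _ _ r0

/-- Erdős–Gallai theorem for paths on `2 * k` vertices, for a graph given as a set of pairs. -/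
theorem erdos_gallai_path [DecidableEq V] (k : ℕ) (hk : 1 ≤ k) (N : ℕ) :
    ∀ (X : Finset V) (E : Finset (Finset V)), X.card = N →
      (∀ p ∈ E, p ⊆ X ∧ p.card = 2) → (k - 1) * X.card < E.card →
      ∃ l : List V, l.Nodup ∧ l.length = 2 * k ∧
        List.IsChain (fun a b => ({a, b} : Finset V) ∈ E) l := by
  induction N using Nat.strong_induction_on with
  | _ N ih =>
  intro X E hX hE hcard
  -- passing to a subset
  have hsubset : ∀ Y ⊆ X, Y.card < X.card →
      (k - 1) * Y.card < (E.filter (fun p => p ⊆ Y)).card →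
      ∃ l : List V, l.Nodup ∧ l.length = 2 * k ∧
        List.IsChain (fun a b => ({a, b} : Finset V) ∈ E) l := by
    intro Y hY hYc hYE
    obtain ⟨l, h1, h2, h3⟩ := ih Y.card (by omega) Y (E.filter (fun p => p ⊆ Y)) rfl
      (fun p hp => ⟨(Finset.mem_filter.1 hp).2, (hE p (Finset.mem_filter.1 hp).1).2⟩) hYE
    exact ⟨l, h1, h2, h3.imp (fun a b h => (Finset.mem_filter.1 h).1)⟩
  -- minimum degree
  by_cases hdeg : ∃ v ∈ X, (E.filter (fun p => v ∈ p)).card ≤ k - 1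
  · obtain ⟨v, hv, hvd⟩ := hdeg
    have hXe : (X.erase v).card + 1 = X.card := Finset.card_erase_add_one hv
    apply hsubset (X.erase v) (Finset.erase_subset _ _) (by omega)
    have h1 : E.card = (E.filter (fun p => v ∈ p)).card + (E.filter (fun p => ¬ v ∈ p)).card :=
      (Finset.card_filter_add_card_filter_not _).symm
    have h2 : (E.filter (fun p => ¬ v ∈ p)).card ≤ (E.filter (fun p => p ⊆ X.erase v)).card := by
      apply Finset.card_le_card
      intro p hp
      rw [Finset.mem_filter] at hp ⊢
      exact ⟨hp.1, Finset.subset_erase.2 ⟨(hE p hp.1).1, hp.2⟩⟩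
    rw [← hXe, mul_add, mul_one] at hcard
    omega
  push Not at hdeg
  -- connectivity
  by_cases hconn : ∃ Y ⊆ X, Y.Nonempty ∧ Y ≠ X ∧ ∀ p ∈ E, p ⊆ Y ∨ p ⊆ X \ Y
  · obtain ⟨Y, hYX, hYne, hYX', hY⟩ := hconn
    have hYc : Y.card < X.card := Finset.card_lt_card (Finset.ssubset_iff_subset_ne.2 ⟨hYX, hYX'⟩)
    have hYpos : 0 < Y.card := hYne.card_pos
    have hsd : (X \ Y).card + Y.card = X.card := Finset.card_sdiff_add_card_eq_card hYX
    have hE' : E.card ≤ (E.filter (fun p => p ⊆ Y)).card + (E.filter (fun p => p ⊆ X \ Y)).card := by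
      refine le_trans (Finset.card_le_card ?_) (Finset.card_union_le _ _)
      intro p hp
      rw [Finset.mem_union, Finset.mem_filter, Finset.mem_filter]
      rcases hY p hp with h | h
      · exact Or.inl ⟨hp, h⟩
      · exact Or.inr ⟨hp, h⟩
    by_cases hd : (k - 1) * Y.card < (E.filter (fun p => p ⊆ Y)).card
    · exact hsubset Y hYX hYc hd
    · apply hsubset (X \ Y) Finset.sdiff_subset (by omega)
      rw [← hsd, mul_add] at hcard
      omega
  push Not at hconn
  have hXpos : 0 < X.card := by
    rcases Nat.eq_zero_or_pos X.card with h0 | h0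
    · exfalso
      have hX0 : X = ∅ := Finset.card_eq_zero.1 h0
      have hEpos : 0 < E.card := by omega
      obtain ⟨p, hp⟩ := Finset.card_pos.1 hEpos
      have := hE p hp
      rw [hX0, Finset.subset_empty] at this
      obtain ⟨h, h'⟩ := this
      rw [h] at h'
      simp at h'
    · exact h0
  have hXbig : 2 * k ≤ X.card := by
    have h1 : E.card ≤ X.card.choose 2 := by
      rw [← Finset.card_powersetCard]
      exact Finset.card_le_card (fun p hp => Finset.mem_powersetCard.2 (hE p hp))
    have h2 : X.card.choose 2 * 2 = X.card * (X.card - 1) := by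
      rw [Nat.choose_two_right]
      exact Nat.div_mul_cancel (Nat.even_mul_pred_self _).two_dvd
    by_contra hlt
    have h3 : X.card * (X.card - 1) ≤ X.card * (2 * (k - 1)) :=
      Nat.mul_le_mul_left _ (by omega)
    nlinarith
  set R : V → V → Prop := fun a b => ({a, b} : Finset V) ∈ E with hR
  have hsymm : ∀ a b, R a b → R b a := by
    intro a b h
    simp only [hR] at h ⊢
    rwa [Finset.pair_comm]
  have hRne : ∀ a b, R a b → a ≠ b := by
    intro a b h hab
    subst hab
    have := (hE _ h).2
    simp at this
  have hRX : ∀ a b, R a b → a ∈ X ∧ b ∈ X := by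
    intro a b h
    have := (hE _ h).1
    exact ⟨this (by simp), this (by simp)⟩
  -- neighbourhoods
  have hnbr : ∀ v ∈ X, k ≤ (X.filter (fun u => R v u)).card := by
    intro v hv
    have h1 := hdeg v hv
    have h2 : (E.filter (fun p => v ∈ p)) ⊆ (X.filter (fun u => R v u)).image (fun u => {v, u}) := by
      intro p hp
      rw [Finset.mem_filter] at hp
      obtain ⟨a, b, hab, rfl⟩ := Finset.card_eq_two.1 (hE p hp.1).2
      rw [Finset.mem_image]
      have hvab := hp.2
      simp only [Finset.mem_insert, Finset.mem_singleton] at hvab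
      rcases hvab with h | h
      · subst h
        exact ⟨b, Finset.mem_filter.2 ⟨(hRX _ _ hp.1).2, hp.1⟩, rfl⟩
      · subst h
        exact ⟨a, Finset.mem_filter.2 ⟨(hRX _ _ hp.1).1, hsymm _ _ hp.1⟩, Finset.pair_comm _ _⟩
    have h3 := (Finset.card_le_card h2).trans Finset.card_image_le
    omega
  by_contra hno
  -- longest path
  let Good : List V → Prop := fun l => l.Nodup ∧ List.IsChain R l ∧ ∀ x ∈ l, x ∈ X
  have hshort : ∀ l, Good l → l.length < 2 * k := by
    intro l hl
    by_contra hlong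
    apply hno
    refine ⟨l.take (2 * k), hl.1.sublist (List.take_sublist _ _), ?_, ?_⟩
    · rw [List.length_take]; omega
    · have := hl.2.1
      rw [← List.take_append_drop (2 * k) l, List.isChain_append] at this
      exact this.1
  have hmax : ∃ l, Good l ∧ l ≠ [] ∧ ∀ l', Good l' → l'.length ≤ l.length := by
    obtain ⟨x, hx⟩ := Finset.card_pos.1 hXpos
    have hex : ∃ L, ∃ l, Good l ∧ l.length = L := ⟨1, [x], by simp [Good, hx], rfl⟩
    have hbd : ∀ L, (∃ l, Good l ∧ l.length = L) → L ≤ 2 * k := by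
      rintro L ⟨l, hl, rfl⟩
      exact (hshort l hl).le
    classical
    obtain ⟨l, hl, hlL⟩ := Nat.findGreatest_spec (P := fun L => ∃ l, Good l ∧ l.length = L)
      (n := 2 * k) (m := 1) (by omega) ⟨[x], by simp [Good, hx], rfl⟩
    have hle : ∀ l', Good l' → l'.length ≤ l.length := by
      intro l' hl'
      rw [hlL]
      exact Nat.le_findGreatest (hbd _ ⟨l', hl', rfl⟩) ⟨l', hl', rfl⟩
    refine ⟨l, hl, ?_, hle⟩
    rintro rfl
    have := hle [x] (by simp [Good, hx])
    simp at this
  obtain ⟨l, hl, hne, hlmax⟩ := hmax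
  have hll := hshort l hl
  have hheadX : l.head hne ∈ X := hl.2.2 _ (List.head_mem hne)
  have hlastX : l.getLast hne ∈ X := hl.2.2 _ (List.getLast_mem hne)
  obtain ⟨c, hcp, hcc, hclose⟩ := exists_cross hsymm k hl.1 hl.2.1 hne hll
    (X.filter (fun u => R (l.head hne) u)) (X.filter (fun u => R (l.getLast hne) u))
    (hnbr _ hheadX) (hnbr _ hlastX)
    (by
      intro u hu
      rw [Finset.mem_filter] at hu
      refine ⟨?_, (hRne _ _ hu.2).symm, hu.2⟩
      by_contra hul
      have := hlmax (u :: l) ⟨List.nodup_cons.2 ⟨hul, hl.1⟩, ?_, ?_⟩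
      · simp at this
      · exact List.IsChain.cons_of_ne_nil hne hl.2.1 (hsymm _ _ hu.2)
      · intro x hx
        rcases List.mem_cons.1 hx with h | h
        · rw [h]; exact hu.1
        · exact hl.2.2 x h)
    (by
      intro u hu
      rw [Finset.mem_filter] at hu
      refine ⟨?_, (hRne _ _ hu.2).symm, hu.2⟩
      by_contra hul
      have := hlmax (l ++ [u]) ⟨?_, ?_, ?_⟩
      · simp at this
      · rw [List.nodup_append]
        refine ⟨hl.1, by simp, ?_⟩
        intro a ha b hb
        simp at hb
        subst hb
        rintro rfl
        exact hul ha
      · refine List.isChain_append.2 ⟨hl.2.1, by simp, ?_⟩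
        intro a ha b hb
        rw [List.getLast?_eq_getLast_of_ne_nil hne] at ha
        simp at ha hb
        subst ha hb
        exact hu.2
      · intro x hx
        rcases List.mem_append.1 hx with h | h
        · exact hl.2.2 x h
        · simp at h; rw [h]; exact hu.1)
  -- the cycle does not cover `X`, so it can be extended
  have hYX : l.toFinset ⊆ X := fun x hx => hl.2.2 x (List.mem_toFinset.1 hx)
  have hYcard : l.toFinset.card = l.length := List.toFinset_card_of_nodup hl.1
  obtain ⟨p, hpE, hp1, hp2⟩ := hconn l.toFinset hYX
    ⟨l.head hne, List.mem_toFinset.2 (List.head_mem hne)⟩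
    (by intro h; rw [h] at hYcard; omega)
  have hcross : ∃ x y, R x y ∧ x ∈ l ∧ y ∉ l := by
    obtain ⟨a, b, hab, rfl⟩ := Finset.card_eq_two.1 (hE p hpE).2
    have hRab : R a b := hpE
    have hX := hRX _ _ hRab
    by_cases ha : a ∈ l
    · by_cases hb : b ∈ l
      · exfalso
        apply hp1
        intro z hz
        simp at hz
        rcases hz with rfl | rfl <;> simp [ha, hb]
      · exact ⟨a, b, hRab, ha, hb⟩
    · by_cases hb : b ∈ l
      · exact ⟨b, a, hsymm _ _ hRab, hb, ha⟩
      · exfalso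
        apply hp2
        intro z hz
        simp at hz
        rcases hz with rfl | rfl <;> simp [ha, hb, hX.1, hX.2]
  obtain ⟨x, y, hxy, hxl, hyl⟩ := hcross
  obtain ⟨s, t, hst⟩ := List.append_of_mem (hcp.mem_iff.2 hxl)
  subst hst
  have hrot := chain_rotate hcc hclose
  have hperm : (t ++ (s ++ [x])).Perm l := by
    refine List.Perm.trans ?_ hcp
    rw [← List.append_assoc]
    refine (List.perm_append_comm (l₁ := t ++ s) (l₂ := [x])).trans ?_
    refine List.Perm.trans ?_ List.perm_middle.symm
    exact (List.perm_append_comm (l₁ := t) (l₂ := s)).cons x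
  have := hlmax ((t ++ (s ++ [x])) ++ [y]) ⟨?_, ?_, ?_⟩
  · have hlen := hperm.length_eq
    rw [List.length_append, hlen] at this
    simp at this
  · rw [List.nodup_append]
    refine ⟨hperm.nodup_iff.2 hl.1, by simp, ?_⟩
    intro a ha b hb
    simp only [List.mem_singleton] at hb
    subst hb
    rintro rfl
    exact hyl (hperm.mem_iff.1 ha)
  · refine List.isChain_append.2 ⟨hrot, by simp, ?_⟩
    intro a ha b hb
    rw [← List.append_assoc, List.getLast?_append] at ha
    simp at ha hb
    subst ha hb
    exact hxy
  · intro z hz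
    rcases List.mem_append.1 hz with h | h
    · exact hl.2.2 z (hperm.mem_iff.1 h)
    · simp at h; rw [h]; exact (hRX _ _ hxy).2

end Paths

/-! ### Cycles and Berge cycles -/

section Cycles

variable {V : Type*}

/-- cyclic successor of an index below `N` -/
def nx (N i : ℕ) : ℕ := if i + 1 < N then i + 1 else 0

lemma nx_lt {N i : ℕ} (h : i < N) : nx N i < N := by
  unfold nx; split_ifs <;> omega

lemma fin_sub_val_one {N : ℕ} (u v : Fin N) (hN : 3 ≤ N) (h : (u - v).val = 1) :
    u.val = nx N v.val := by
  rw [Fin.sub_def] at h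
  simp only at h
  have hu := u.2
  have hv := v.2
  unfold nx
  rcases lt_or_ge (N - v.val + u.val) N with h1 | h1
  · rw [Nat.mod_eq_of_lt h1] at h
    split_ifs <;> omega
  · rw [Nat.mod_eq_sub_mod h1, Nat.mod_eq_of_lt (by omega)] at h
    split_ifs <;> omega

lemma cyc_adj_nx {N : ℕ} (hN : 3 ≤ N) (i : ℕ) (hi : i < N) :
    (SimpleGraph.cycleGraph N).Adj ⟨i, hi⟩ ⟨nx N i, nx_lt hi⟩ := by
  rw [SimpleGraph.cycleGraph_adj']
  right
  rw [Fin.sub_def]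
  simp only [nx]
  split_ifs with h
  · rw [Nat.mod_eq_sub_mod (by omega), Nat.mod_eq_of_lt (by omega)]; omega
  · rw [Nat.mod_eq_of_lt (by omega)]; omega

/-- A Berge cycle given by an explicit cyclic sequence. -/
lemma berge_of_seq (H : Finset (Finset V)) (N : ℕ) (hN : 3 ≤ N) (v : ℕ → V)
    (g : ℕ → Finset V) (hv : ∀ i < N, ∀ j < N, v i = v j → i = j)
    (hg : ∀ i < N, ∀ j < N, g i = g j → i = j) (hgH : ∀ i < N, g i ∈ H)
    (h1 : ∀ i < N, v i ∈ g i) (h2 : ∀ i < N, v (nx N i) ∈ g i) :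
    HasBergeCopy (SimpleGraph.cycleGraph N) H := by
  have key : ∀ e : (SimpleGraph.cycleGraph N).edgeSet, ∃ i : Fin N,
      (e : Sym2 (Fin N)) = s(i, ⟨nx N i, nx_lt i.2⟩) := by
    rintro ⟨e, he⟩
    induction e with
    | _ a b =>
    rw [SimpleGraph.mem_edgeSet, SimpleGraph.cycleGraph_adj'] at he
    rcases he with h | h
    · refine ⟨b, ?_⟩
      have := fin_sub_val_one _ _ hN h
      have ha : a = ⟨nx N b, nx_lt b.2⟩ := Fin.ext this
      simp only
      rw [← ha, Sym2.eq_swap]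
    · refine ⟨a, ?_⟩
      have := fin_sub_val_one _ _ hN h
      have ha : b = ⟨nx N a, nx_lt a.2⟩ := Fin.ext this
      simp only
      rw [← ha]
  choose idx hidx using key
  refine ⟨⟨fun i => v i, fun i j h => Fin.ext (hv i i.2 j j.2 h)⟩, fun e => g (idx e), ?_, ?_⟩
  · intro e e' h
    have := hg _ (idx e).2 _ (idx e').2 h
    have h' : idx e = idx e' := Fin.ext this
    apply Subtype.ext
    rw [hidx e, hidx e', h']
  · intro e
    refine ⟨hgH _ (idx e).2, ?_⟩
    intro x hx
    rw [hidx e, Sym2.mem_iff] at hx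
    rcases hx with rfl | rfl
    · exact h1 _ (idx e).2
    · exact h2 _ (idx e).2

variable [DecidableEq V]

/-- The `i`-th pair of a cyclic sequence. -/
def cp (N : ℕ) (v : ℕ → V) (i : ℕ) : Finset V := {v i, v (nx N i)}

lemma cp_inj {N : ℕ} (hN : 3 ≤ N) {v : ℕ → V} (hv : ∀ i < N, ∀ j < N, v i = v j → i = j) :
    ∀ i < N, ∀ j < N, cp N v i = cp N v j → i = j := by
  intro i hi j hj h
  have a1 : v i ∈ cp N v j := by rw [← h]; simp [cp]
  have a2 : v (nx N i) ∈ cp N v j := by rw [← h]; simp [cp]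
  simp only [cp, Finset.mem_insert, Finset.mem_singleton] at a1 a2
  have b1 : i = j ∨ i = nx N j := a1.imp (hv _ hi _ hj) (hv _ hi _ (nx_lt hj))
  have b2 : nx N i = j ∨ nx N i = nx N j := a2.imp (hv _ (nx_lt hi) _ hj)
    (hv _ (nx_lt hi) _ (nx_lt hj))
  unfold nx at b1 b2
  by_cases c1 : i + 1 < N <;> by_cases c2 : j + 1 < N <;>
    simp only [c1, c2, if_true, if_false] at b1 b2 <;> omega

/-- `v` is a cycle of length `N` in the graph with edge set `P`. -/
def IsCyc (P : Finset (Finset V)) (N : ℕ) (v : ℕ → V) : Prop :=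
  (∀ i < N, ∀ j < N, v i = v j → i = j) ∧ ∀ i < N, cp N v i ∈ P

lemma berge_of_cyc (H P : Finset (Finset V)) (N : ℕ) (hN : 3 ≤ N) (v : ℕ → V)
    (ρ : Finset V → Finset V) (hv : IsCyc P N v) (hρ : Set.InjOn ρ P)
    (hρH : ∀ p ∈ P, ρ p ∈ H) (hρp : ∀ p ∈ P, p ⊆ ρ p) :
    HasBergeCopy (SimpleGraph.cycleGraph N) H := by
  refine berge_of_seq H N hN v (fun i => ρ (cp N v i)) hv.1 ?_ ?_ ?_ ?_
  · intro i hi j hj h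
    exact cp_inj hN hv.1 i hi j hj (hρ (hv.2 i hi) (hv.2 j hj) h)
  · intro i hi
    exact hρH _ (hv.2 i hi)
  · intro i hi
    exact hρp _ (hv.2 i hi) (by simp [cp])
  · intro i hi
    exact hρp _ (hv.2 i hi) (by simp [cp])

/-- Replace the closing edge of a cycle by a path of length two through `w`. -/
lemma berge_of_cyc_ext (H P : Finset (Finset V)) (N : ℕ) (hN : 3 ≤ N) (v : ℕ → V)
    (ρ : Finset V → Finset V) (hv : IsCyc P N v) (hρ : Set.InjOn ρ P)
    (hρH : ∀ p ∈ P, ρ p ∈ H) (hρp : ∀ p ∈ P, p ⊆ ρ p) (w : V) (hw : ∀ i < N, w ≠ v i)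
    (g1 g2 : Finset V) (h12 : g1 ≠ g2) (hg1 : g1 ∈ H) (hg2 : g2 ∈ H)
    (h1 : v (N - 1) ∈ g1) (h1w : w ∈ g1) (h2 : v 0 ∈ g2) (h2w : w ∈ g2)
    (hq : ∀ i, i + 1 < N → ρ (cp N v i) ≠ g1 ∧ ρ (cp N v i) ≠ g2) :
    HasBergeCopy (SimpleGraph.cycleGraph (N + 1)) H := by
  have hcp : ∀ i, i + 1 < N → cp N v i = {v i, v (i + 1)} := by
    intro i hi
    simp [cp, nx, hi]
  refine berge_of_seq H (N + 1) (by omega) (fun i => if i < N then v i else w)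
    (fun i => if i + 1 < N then ρ (cp N v i) else if i < N then g1 else g2) ?_ ?_ ?_ ?_ ?_
  · intro i hi j hj h
    split_ifs at h with a b b
    · exact hv.1 i a j b h
    · exact absurd h.symm (hw i a)
    · exact absurd h (hw j b)
    · omega
  · intro i hi j hj h
    split_ifs at h with a b b b b b b b b
    · exact cp_inj hN hv.1 i (by omega) j (by omega)
        (hρ (hv.2 i (by omega)) (hv.2 j (by omega)) h)
    · exact absurd h (hq i a).1
    · exact absurd h (hq i a).2
    · exact absurd h.symm (hq j (by assumption)).1
    · omega
    · exact absurd h h12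
    · exact absurd h.symm (hq j (by assumption)).2
    · exact absurd h.symm h12
    · omega
  · intro i hi
    split_ifs with a b
    · exact hρH _ (hv.2 i (by omega))
    · exact hg1
    · exact hg2
  · intro i hi
    rcases lt_trichotomy (i + 1) N with a | a | a
    · have a2 : i < N := by omega
      simp only [a, a2, if_true]
      exact hρp _ (hv.2 i (by omega)) (by simp [cp])
    · have a1 : ¬ (i + 1 < N) := by omega
      have a2 : i < N := by omega
      simp only [a1, a2, if_true, if_false]
      have : i = N - 1 := by omega
      rw [this]; exact h1
    · have a1 : ¬ (i + 1 < N) := by omega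
      have a2 : ¬ i < N := by omega
      simp only [a1, a2, if_false]
      exact h2w
  · intro i hi
    rcases lt_trichotomy (i + 1) N with a | a | a
    · have e1 : nx (N + 1) i = i + 1 := by unfold nx; rw [if_pos (by omega)]
      simp only [e1, a, if_true]
      exact hρp _ (hv.2 i (by omega)) (by simp [hcp i a])
    · have e1 : nx (N + 1) i = i + 1 := by unfold nx; rw [if_pos (by omega)]
      simp only [e1]
      have a1 : ¬ (i + 1 < N) := by omega
      have a2 : i < N := by omega
      simp only [a1, a2, if_true, if_false]
      exact h1w
    · have e1 : nx (N + 1) i = 0 := by unfold nx; rw [if_neg (by omega)]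
      simp only [e1]
      have a1 : ¬ (i + 1 < N) := by omega
      have a2 : ¬ i < N := by omega
      have a3 : 0 < N := by omega
      simp only [a1, a2, a3, if_true, if_false]
      exact h2

lemma exTuran_bdd {α : Type*} (n : ℕ) (F : SimpleGraph α) :
    BddAbove {m | ∃ G : SimpleGraph (Fin n), ¬ HasCopy F G ∧ edgeCount G = m} := by
  refine ⟨Nat.card (Sym2 (Fin n)), ?_⟩
  rintro m ⟨G, _, rfl⟩
  unfold edgeCount
  rw [← Set.ncard_univ]
  exact Set.ncard_le_ncard (Set.subset_univ _) Set.finite_univ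

/-- A set of pairs inside `A` without `C_N` has size at most the Turán number. -/
lemma turan_bound_s2 (N : ℕ) (hN : 3 ≤ N) (P : Finset (Finset V)) (A : Finset V)
    (hP : ∀ p ∈ P, p ⊆ A ∧ p.card = 2) (hno : ∀ v, ¬ IsCyc P N v) :
    P.card ≤ exTuran A.card (SimpleGraph.cycleGraph N) := by
  classical
  let σ : Fin A.card ≃ A := A.equivFin.symm
  let G : SimpleGraph (Fin A.card) :=
    { Adj := fun i j => i ≠ j ∧ ({(σ i : V), (σ j : V)} : Finset V) ∈ P
      symm := ⟨fun i j h => ⟨h.1.symm, by rw [Finset.pair_comm]; exact h.2⟩⟩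
      loopless := ⟨fun i h => h.1 rfl⟩ }
  have hG : ¬ HasCopy (SimpleGraph.cycleGraph N) G := by
    rintro ⟨φ, hφ⟩
    apply hno (fun i => if h : i < N then (σ (φ ⟨i, h⟩) : V) else (σ (φ ⟨0, by omega⟩) : V))
    constructor
    · intro i hi j hj h
      simp only [dif_pos hi, dif_pos hj] at h
      have := φ.injective (σ.injective (Subtype.ext h))
      simpa using this
    · intro i hi
      unfold cp
      beta_reduce
      rw [dif_pos hi, dif_pos (nx_lt hi)]
      exact (hφ (cyc_adj_nx hN i hi)).2
  have hle : P.card ≤ edgeCount G := by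
    unfold edgeCount
    rw [Set.ncard_eq_toFinset_card']
    have hsub : P ⊆ G.edgeSet.toFinset.image
        (fun e => (Finset.univ.filter (fun i => i ∈ e)).image (fun i => (σ i : V))) := by
      intro p hp
      obtain ⟨a, b, hab, rfl⟩ := Finset.card_eq_two.1 (hP p hp).2
      have ha : a ∈ A := (hP _ hp).1 (by simp)
      have hb : b ∈ A := (hP _ hp).1 (by simp)
      refine Finset.mem_image.2 ⟨s(σ.symm ⟨a, ha⟩, σ.symm ⟨b, hb⟩), ?_, ?_⟩
      · rw [Set.mem_toFinset, SimpleGraph.mem_edgeSet]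
        refine ⟨?_, by simpa using hp⟩
        intro h
        have := σ.symm.injective h
        simp at this
        exact hab this
      · ext x
        simp only [Finset.mem_image, Finset.mem_filter, Finset.mem_univ, true_and, Sym2.mem_iff,
          Finset.mem_insert, Finset.mem_singleton]
        constructor
        · rintro ⟨i, rfl | rfl, rfl⟩ <;> simp
        · rintro (rfl | rfl)
          · exact ⟨_, Or.inl rfl, by simp⟩
          · exact ⟨_, Or.inr rfl, by simp⟩
    exact (Finset.card_le_card hsub).trans Finset.card_image_le
  exact hle.trans (le_csSup (exTuran_bdd _ _) ⟨G, hG, rfl⟩)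

/-- The shadow: the set of pairs contained in a member of `S`. -/
def shad (S : Finset (Finset V)) : Finset (Finset V) := S.biUnion (fun e => e.powersetCard 2)

lemma mem_shad {S : Finset (Finset V)} {p : Finset V} :
    p ∈ shad S ↔ ∃ e ∈ S, p ⊆ e ∧ p.card = 2 := by
  simp [shad, Finset.mem_powersetCard]

lemma sum_degree [Fintype V] (S : Finset (Finset V)) (r : ℕ) (hS : ∀ e ∈ S, e.card = r) :
    ∑ v : V, (S.filter (fun e => v ∈ e)).card = r * S.card := by
  have h := Finset.sum_card_bipartiteAbove_eq_sum_card_bipartiteBelow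
    (s := (Finset.univ : Finset V)) (t := S) (fun v e => v ∈ e)
  simp only [Finset.bipartiteAbove, Finset.bipartiteBelow] at h
  rw [h, Finset.sum_congr rfl (g := fun _ => r)]
  · simp [mul_comm]
  · intro e he
    rw [← hS e he]
    simp

/-- Counting the hyperedges whose shadow has a system of distinct representatives. -/
lemma blue_count [Fintype V] (k : ℕ) (hk : 1 < k) (H S : Finset (Finset V)) (hSH : S ⊆ H)
    (h3 : ∀ e ∈ H, e.card = 3)
    (hno : ¬ HasBergeCopy (SimpleGraph.cycleGraph (2 * k + 1)) H) (ν : Finset V → Finset V)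
    (hν : Set.InjOn ν (shad S)) (hνS : ∀ p ∈ shad S, ν p ∈ S ∧ p ⊆ ν p) :
    3 * S.card ≤ 2 * (k - 1) * (shad S).card := by
  have hdeg : ∀ v : V, (S.filter (fun e => v ∈ e)).card ≤
      (k - 1) * ((shad S).filter (fun p => v ∈ p)).card := by
    intro v
    set X : Finset V := Finset.univ.filter (fun u => u ≠ v ∧ ({u, v} : Finset V) ∈ shad S) with hX
    set E : Finset (Finset V) := (S.filter (fun e => v ∈ e)).image (fun e => e.erase v) with hE
    have hEc : E.card = (S.filter (fun e => v ∈ e)).card := by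
      apply Finset.card_image_of_injOn
      intro a ha b hb h
      simp only [Finset.coe_filter, Set.mem_setOf_eq] at ha hb
      simp only at h
      rw [← Finset.insert_erase ha.2, ← Finset.insert_erase hb.2, h]
    have hXc : X.card ≤ ((shad S).filter (fun p => v ∈ p)).card := by
      apply Finset.card_le_card_of_injOn (fun u => ({u, v} : Finset V))
      · intro u hu
        simp only [hX, Finset.coe_filter, Set.mem_setOf_eq, Finset.mem_univ, true_and] at hu ⊢
        exact ⟨hu.2, by simp⟩
      · intro a ha b hb h
        simp only [hX, Finset.coe_filter, Set.mem_setOf_eq, Finset.mem_univ, true_and] at ha hb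
        have : a ∈ ({b, v} : Finset V) := by
          simp only at h
          rw [← h]; simp
        simp only [Finset.mem_insert, Finset.mem_singleton] at this
        exact this.resolve_right ha.1
    have hEX : ∀ p ∈ E, p ⊆ X ∧ p.card = 2 := by
      intro p hp
      simp only [hE, Finset.mem_image, Finset.mem_filter] at hp
      obtain ⟨e, ⟨he, hve⟩, rfl⟩ := hp
      constructor
      · intro u hu
        rw [Finset.mem_erase] at hu
        simp only [hX, Finset.mem_filter, Finset.mem_univ, true_and]
        refine ⟨hu.1, mem_shad.2 ⟨e, he, ?_, Finset.card_pair hu.1⟩⟩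
        intro z hz
        simp only [Finset.mem_insert, Finset.mem_singleton] at hz
        rcases hz with rfl | rfl
        · exact hu.2
        · exact hve
      · rw [Finset.card_erase_of_mem hve, h3 e (hSH he)]
    by_contra hlt
    push Not at hlt
    obtain ⟨l, hnd, hlen, hch⟩ := erdos_gallai_path k (by omega) _ X E rfl hEX (by
      rw [hEc]
      exact lt_of_le_of_lt (Nat.mul_le_mul_left _ hXc) hlt)
    apply hno
    have hEdge : ∀ a b, ({a, b} : Finset V) ∈ E → ({a, b} : Finset V) ∈ shad S := by
      intro a b hab
      have hc := (hEX _ hab).2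
      simp only [hE, Finset.mem_image, Finset.mem_filter] at hab
      obtain ⟨e, ⟨he, hve⟩, heq⟩ := hab
      refine mem_shad.2 ⟨e, he, ?_, hc⟩
      rw [← heq]
      exact Finset.erase_subset _ _
    have hlX : ∀ i (hi : i < 2 * k), l[i] ∈ X := by
      intro i hi
      rw [List.isChain_iff_getElem] at hch
      by_cases h : i + 1 < 2 * k
      · exact (hEX _ (hch i (by omega))).1 (by simp)
      · obtain ⟨j, rfl⟩ : ∃ j, i = j + 1 := ⟨i - 1, by omega⟩
        exact (hEX _ (hch j (by omega))).1 (by simp)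
    have hXv : ∀ u ∈ X, u ≠ v ∧ ({u, v} : Finset V) ∈ shad S := by
      intro u hu
      simpa [hX] using hu
    rw [List.isChain_iff_getElem] at hch
    refine berge_of_cyc H (shad S) (2 * k + 1) (by omega)
      (fun i => if h : i < l.length then l[i] else v) ν ⟨?_, ?_⟩ hν
      (fun p hp => hSH (hνS p hp).1) (fun p hp => (hνS p hp).2)
    · intro i hi j hj h
      simp only at h
      split_ifs at h with a b b
      · exact (List.Nodup.getElem_inj_iff hnd).1 h
      · exact absurd h (hXv _ (hlX i (by omega))).1
      · exact absurd h.symm (hXv _ (hlX j (by omega))).1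
      · omega
    · intro i hi
      unfold cp
      beta_reduce
      rcases lt_trichotomy (i + 1) (2 * k) with a | a | a
      · have e1 : nx (2 * k + 1) i = i + 1 := by unfold nx; rw [if_pos (by omega)]
        rw [e1, dif_pos (by omega), dif_pos (by omega)]
        exact hEdge _ _ (hch i (by omega))
      · have e1 : nx (2 * k + 1) i = i + 1 := by unfold nx; rw [if_pos (by omega)]
        rw [e1, dif_pos (by omega), dif_neg (by omega)]
        exact (hXv _ (hlX i (by omega))).2
      · have e1 : nx (2 * k + 1) i = 0 := by unfold nx; rw [if_neg (by omega)]
        rw [e1, dif_neg (by omega), dif_pos (by omega), Finset.pair_comm]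
        exact (hXv _ (hlX 0 (by omega))).2
  have s1 := sum_degree S 3 (fun e he => h3 e (hSH he))
  have s2 := sum_degree (shad S) 2 (fun p hp => by
    obtain ⟨e, _, _, h⟩ := mem_shad.1 hp
    exact h)
  rw [← s1]
  calc ∑ v : V, (S.filter (fun e => v ∈ e)).card
      ≤ ∑ v : V, (k - 1) * ((shad S).filter (fun p => v ∈ p)).card :=
        Finset.sum_le_sum (fun v _ => hdeg v)
    _ = 2 * (k - 1) * (shad S).card := by
        rw [← Finset.mul_sum, s2]; ring

end Cycles

/-! ### Splitting the hypergraph -/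

section Split

variable {V : Type*} [DecidableEq V]

lemma hall_on {α β : Type*} [DecidableEq α] [DecidableEq β] [Inhabited β] (A : Finset α)
    (t : α → Finset β) (h : ∀ s ⊆ A, s.card ≤ (s.biUnion t).card) :
    ∃ f : α → β, Set.InjOn f A ∧ ∀ a ∈ A, f a ∈ t a := by
  have := (Finset.all_card_le_biUnion_card_iff_exists_injective
    (fun a : {a // a ∈ A} => t a.1)).1 (by
      intro s
      have h1 := h (s.map (Function.Embedding.subtype _)) (by
        intro x hx
        simp only [Finset.mem_map, Function.Embedding.subtype_apply] at hx
        obtain ⟨y, _, rfl⟩ := hx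
        exact y.2)
      rw [Finset.card_map] at h1
      refine h1.trans (Finset.card_le_card ?_)
      intro x hx
      simp only [Finset.mem_biUnion, Finset.mem_map, Function.Embedding.subtype_apply] at hx ⊢
      obtain ⟨a, ⟨y, hy, rfl⟩, hx⟩ := hx
      exact ⟨y, hy, hx⟩)
  obtain ⟨f, hf, hft⟩ := this
  refine ⟨fun a => if h : a ∈ A then f ⟨a, h⟩ else default, ?_, ?_⟩
  · intro a ha b hb hab
    have ha' : a ∈ A := ha
    have hb' : b ∈ A := hb
    simp only [dif_pos ha', dif_pos hb'] at hab
    exact congrArg Subtype.val (hf hab)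
  · intro a ha
    simp only [dif_pos ha]
    exact hft ⟨a, ha⟩

/-- a valid choice of pairs for the hyperedges outside `S` -/
def Valid (H S : Finset (Finset V)) (μ : Finset V → Finset V) : Prop :=
  Set.InjOn μ ((H \ S : Finset (Finset V)) : Set (Finset V)) ∧
    ∀ e ∈ H \ S, μ e ⊆ e ∧ (μ e).card = 2 ∧ μ e ∉ shad S

lemma split_lemma (H : Finset (Finset V)) :
    ∃ S ⊆ H, (∃ ν : Finset V → Finset V, Set.InjOn ν (shad S) ∧
        ∀ p ∈ shad S, ν p ∈ S ∧ p ⊆ ν p) ∧ ∃ μ, Valid H S μ := by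
  obtain ⟨S, hS, hmax⟩ := Finset.exists_max_image H.powerset
    (fun S => (S.card : ℤ) - ((shad S).card : ℤ)) ⟨∅, by simp⟩
  rw [Finset.mem_powerset] at hS
  refine ⟨S, hS, ?_, ?_⟩
  · obtain ⟨f, hf, hft⟩ := hall_on (shad S) (fun p => S.filter (fun e => p ⊆ e)) (by
      intro s hs
      set T := s.biUnion (fun p => S.filter (fun e => p ⊆ e)) with hT
      have hTS : T ⊆ S := by
        intro e he
        simp only [hT, Finset.mem_biUnion, Finset.mem_filter] at he
        obtain ⟨_, _, he, _⟩ := he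
        exact he
      have h1 := hmax (S \ T) (by
        rw [Finset.mem_powerset]; exact Finset.sdiff_subset.trans hS)
      have h2 : shad (S \ T) ⊆ shad S \ s := by
        intro p hp
        obtain ⟨e, he, hpe, hp2⟩ := mem_shad.1 hp
        rw [Finset.mem_sdiff] at he ⊢
        refine ⟨mem_shad.2 ⟨e, he.1, hpe, hp2⟩, fun hps => he.2 ?_⟩
        simp only [hT, Finset.mem_biUnion, Finset.mem_filter]
        exact ⟨p, hps, he.1, hpe⟩
      have h3 := Finset.card_le_card h2
      rw [Finset.card_sdiff_of_subset hs] at h3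
      have h4 := Finset.card_le_card hs
      have h5 := Finset.card_le_card hTS
      simp only [Finset.card_sdiff_of_subset hTS] at h1
      omega)
    refine ⟨f, hf, fun p hp => ?_⟩
    simpa using hft p hp
  · obtain ⟨f, hf, hft⟩ := hall_on (H \ S) (fun e => (e.powersetCard 2) \ shad S) (by
      intro T hT
      set Q := T.biUnion (fun e => (e.powersetCard 2) \ shad S) with hQ
      have hTH : T ⊆ H := hT.trans Finset.sdiff_subset
      have h1 := hmax (S ∪ T) (by
        rw [Finset.mem_powerset]; exact Finset.union_subset hS hTH)
      have hd : Disjoint S T := by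
        rw [Finset.disjoint_left]
        intro e he heT
        exact (Finset.mem_sdiff.1 (hT heT)).2 he
      have h2 : shad (S ∪ T) ⊆ shad S ∪ Q := by
        intro p hp
        obtain ⟨e, he, hpe, hp2⟩ := mem_shad.1 hp
        by_cases hpS : p ∈ shad S
        · exact Finset.mem_union_left _ hpS
        · rw [Finset.mem_union] at he
          rcases he with he | he
          · exact absurd (mem_shad.2 ⟨e, he, hpe, hp2⟩) hpS
          · apply Finset.mem_union_right
            simp only [hQ, Finset.mem_biUnion, Finset.mem_sdiff, Finset.mem_powersetCard]
            exact ⟨e, he, ⟨hpe, hp2⟩, hpS⟩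
      have h3 := (Finset.card_le_card h2).trans (Finset.card_union_le _ _)
      simp only [Finset.card_union_of_disjoint hd] at h1
      push_cast at h1
      omega)
    refine ⟨f, hf, fun e he => ?_⟩
    have := hft e he
    simp only [Finset.mem_sdiff, Finset.mem_powersetCard] at this
    exact ⟨this.1.1, this.1.2, this.2⟩

lemma good_lemma [Fintype V] (H S L : Finset (Finset V)) (hSH : S ⊆ H)
    (h3 : ∀ e ∈ H, e.card = 3) (ν : Finset V → Finset V)
    (hνS : ∀ p ∈ shad S, ν p ∈ S ∧ p ⊆ ν p) (hLU : L ⊆ H \ S)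
    (hL : ∀ e ∈ (H \ S) \ L, ∃ f ∈ L, (f ∩ e).card = 2) (hμ : ∃ μ, Valid H S μ) :
    ∃ μ, Valid H S μ ∧ ∀ e ∈ (H \ S) \ L, ∃ p ⊆ e, p.card = 2 ∧ p ≠ μ e ∧
      ∃ g ∈ H, g ≠ e ∧ p ⊆ g ∧
        (g ∈ L ∨ (g ∈ H \ S ∧ μ g = p) ∨ (p ∈ shad S ∧ g = ν p)) := by
  classical
  let Q : (Finset V → Finset V) → Finset V → Prop :=
    fun μ e => ∃ f ∈ L, (f ∩ e).card = 2 ∧ f ∩ e ≠ μ e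
  obtain ⟨μ0, hμ0⟩ := hμ
  obtain ⟨μ, hμ, hmax⟩ := Finset.exists_max_image
    ((Finset.univ : Finset (Finset V → Finset V)).filter (Valid H S))
    (fun μ => (((H \ S) \ L).filter (Q μ)).card) ⟨μ0, by simpa using hμ0⟩
  simp only [Finset.mem_filter, Finset.mem_univ, true_and] at hμ hmax
  refine ⟨μ, hμ, fun e he => ?_⟩
  have heU : e ∈ H \ S := (Finset.mem_sdiff.1 he).1
  have heL : e ∉ L := (Finset.mem_sdiff.1 he).2
  have heH : e ∈ H := (Finset.mem_sdiff.1 heU).1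
  have heS : e ∉ S := (Finset.mem_sdiff.1 heU).2
  by_cases hQe : Q μ e
  · obtain ⟨f, hf, hf2, hfe⟩ := hQe
    refine ⟨f ∩ e, Finset.inter_subset_right, hf2, hfe, f, (Finset.mem_sdiff.1 (hLU hf)).1, ?_,
      Finset.inter_subset_left, Or.inl hf⟩
    rintro rfl
    exact heL hf
  · obtain ⟨f, hf, hf2⟩ := hL e he
    have hfe : f ∩ e = μ e := by
      by_contra h
      exact hQe ⟨f, hf, hf2, h⟩
    obtain ⟨hme, hmc, hmS⟩ := hμ.2 e heU
    obtain ⟨x, hx⟩ : (μ e).Nonempty := by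
      rw [← Finset.card_pos]; omega
    have hpx : e.erase x ≠ μ e := by
      intro h
      rw [← h] at hx
      simp at hx
    have hpc : (e.erase x).card = 2 := by
      rw [Finset.card_erase_of_mem (hme hx), h3 e heH]
    refine ⟨e.erase x, Finset.erase_subset _ _, hpc, hpx, ?_⟩
    by_cases hpS : e.erase x ∈ shad S
    · refine ⟨ν (e.erase x), hSH (hνS _ hpS).1, ?_, (hνS _ hpS).2, Or.inr (Or.inr ⟨hpS, rfl⟩)⟩
      intro h
      apply heS
      rw [← h]
      exact (hνS _ hpS).1
    · by_cases hpU : ∃ g ∈ H \ S, μ g = e.erase x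
      · obtain ⟨g, hg, hgp⟩ := hpU
        refine ⟨g, (Finset.mem_sdiff.1 hg).1, ?_, ?_, Or.inr (Or.inl ⟨hg, hgp⟩)⟩
        · rintro rfl
          exact hpx hgp.symm
        · rw [← hgp]
          exact (hμ.2 g hg).1
      · exfalso
        push Not at hpU
        set μ' := Function.update μ e (e.erase x) with hμ'
        have e1 : μ' e = e.erase x := by simp [hμ']
        have e2 : ∀ g, g ≠ e → μ' g = μ g := fun g hg => by simp [hμ', hg]
        have hv : Valid H S μ' := by
          constructor
          · intro a ha b hb hab
            by_cases hae : a = e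
            · by_cases hbe : b = e
              · rw [hae, hbe]
              · rw [hae, e1, e2 b hbe] at hab
                exact absurd hab.symm (hpU b hb)
            · by_cases hbe : b = e
              · rw [hbe, e1, e2 a hae] at hab
                exact absurd hab (hpU a ha)
              · rw [e2 a hae, e2 b hbe] at hab
                exact hμ.1 ha hb hab
          · intro a ha
            by_cases hae : a = e
            · rw [hae, e1]
              exact ⟨Finset.erase_subset _ _, hpc, hpS⟩
            · rw [e2 a hae]
              exact hμ.2 a ha
        have hle := hmax μ' hv
        have hsub : insert e (((H \ S) \ L).filter (Q μ)) ⊆ ((H \ S) \ L).filter (Q μ') := by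
          intro a ha
          rw [Finset.mem_insert] at ha
          rcases ha with rfl | ha
          · rw [Finset.mem_filter]
            refine ⟨he, f, hf, hf2, ?_⟩
            rw [hfe, e1]
            exact hpx.symm
          · rw [Finset.mem_filter] at ha ⊢
            refine ⟨ha.1, ?_⟩
            obtain ⟨f', hf', h1, h2⟩ := ha.2
            refine ⟨f', hf', h1, ?_⟩
            rw [e2 a (by rintro rfl; exact hQe ha.2)]
            exact h2
        have := Finset.card_le_card hsub
        rw [Finset.card_insert_of_notMem (by
          rw [Finset.mem_filter]
          exact fun h => hQe h.2)] at this
        omega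

end Split

/-! ### Extending an edge to a path of length two -/

section Ext

variable {V : Type*} [DecidableEq V]

lemma triple_of_pair {e p : Finset V} (he : e.card = 3) (hp : p.card = 2) (hpe : p ⊆ e) :
    ∃ w, w ∉ p ∧ w ∈ e ∧ e = insert w p := by
  have h1 : (e \ p).card = 1 := by rw [Finset.card_sdiff_of_subset hpe]; omega
  obtain ⟨w, hw⟩ := Finset.card_eq_one.1 h1
  have hwm : w ∈ e \ p := by rw [hw]; simp
  rw [Finset.mem_sdiff] at hwm
  refine ⟨w, hwm.2, hwm.1, ?_⟩
  symm
  apply Finset.eq_of_subset_of_card_le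
  · intro x hx
    rw [Finset.mem_insert] at hx
    rcases hx with rfl | hx
    · exact hwm.1
    · exact hpe hx
  · rw [Finset.card_insert_of_notMem hwm.2]; omega

/-- the edge `p` can be replaced by a path of length two through `w` -/
def ExtAt (H P : Finset (Finset V)) (ρ : Finset V → Finset V) (p : Finset V) (w : V) : Prop :=
  ∀ u v, p = {u, v} → ∃ g1 ∈ H, ∃ g2 ∈ H, g1 ≠ g2 ∧ u ∈ g1 ∧ w ∈ g1 ∧ v ∈ g2 ∧ w ∈ g2 ∧
    ∀ q ∈ P, q ≠ p → w ∉ q → ρ q ≠ g1 ∧ ρ q ≠ g2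

lemma ext_lemma [Fintype V] [Nonempty V] (H S L : Finset (Finset V)) (hSH : S ⊆ H)
    (h3 : ∀ e ∈ H, e.card = 3) (ν : Finset V → Finset V) (hν : Set.InjOn ν (shad S))
    (hνS : ∀ p ∈ shad S, ν p ∈ S ∧ p ⊆ ν p) (hLU : L ⊆ H \ S)
    (hL : ∀ e ∈ (H \ S) \ L, ∃ f ∈ L, (f ∩ e).card = 2) (hμ : ∃ μ, Valid H S μ) :
    ∃ P : Finset (Finset V), ∃ ρ : Finset V → Finset V,
      P.card = (shad S).card + ((H \ S) \ L).card ∧ (∀ p ∈ P, p.card = 2) ∧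
      Set.InjOn ρ P ∧ (∀ p ∈ P, ρ p ∈ H ∧ ρ p ∉ L) ∧ (∀ p ∈ P, p ⊆ ρ p) ∧
      ∃ w : Finset V → V, ∀ p ∈ P, w p ∉ p ∧ (p ∉ shad S → w p ∈ ρ p) ∧
        ExtAt H P ρ p (w p) := by
  classical
  obtain ⟨μ, hμv, hgood⟩ := good_lemma H S L hSH h3 ν hνS hLU hL hμ
  set R := (H \ S) \ L with hR
  have hRU : R ⊆ H \ S := Finset.sdiff_subset
  have hRinj : Set.InjOn μ (R : Set (Finset V)) := hμv.1.mono (by exact_mod_cast hRU)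
  let ρ : Finset V → Finset V := fun p => if p ∈ shad S then ν p else
    Function.invFunOn μ (R : Set (Finset V)) p
  set P := shad S ∪ R.image μ with hP
  have hblue : ∀ p ∈ shad S, ρ p = ν p := fun p hp => if_pos hp
  have hredS : ∀ e ∈ R, μ e ∉ shad S := fun e he => (hμv.2 e (hRU he)).2.2
  have hred : ∀ e ∈ R, ρ (μ e) = e := by
    intro e he
    change (if _ then _ else _) = _
    rw [if_neg (hredS e he)]
    exact hRinj.leftInvOn_invFunOn he
  have hcases : ∀ p ∈ P, p ∈ shad S ∨ ∃ e ∈ R, p = μ e := by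
    intro p hp
    rw [hP, Finset.mem_union, Finset.mem_image] at hp
    rcases hp with hp | ⟨e, he, rfl⟩
    · exact Or.inl hp
    · exact Or.inr ⟨e, he, rfl⟩
  have hRnS : ∀ e ∈ R, e ∉ S := fun e he => (Finset.mem_sdiff.1 (hRU he)).2
  have hRH : ∀ e ∈ R, e ∈ H := fun e he => (Finset.mem_sdiff.1 (hRU he)).1
  have hLS : ∀ e ∈ L, e ∉ S := fun e he => (Finset.mem_sdiff.1 (hLU he)).2
  -- which pairs have given representative
  have hρS : ∀ q ∈ P, ∀ p ∈ shad S, ρ q = ν p → q = p := by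
    intro q hq p hp h
    rcases hcases q hq with hq' | ⟨e, he, rfl⟩
    · rw [hblue q hq'] at h
      exact hν hq' hp h
    · rw [hred e he] at h
      exact absurd (h ▸ (hνS p hp).1) (hRnS e he)
  have hρU : ∀ q ∈ P, ∀ g ∈ H \ S, ρ q = g → q = μ g := by
    intro q hq g hg h
    rcases hcases q hq with hq' | ⟨e, he, rfl⟩
    · rw [hblue q hq'] at h
      exact absurd (h ▸ (hνS q hq').1) (Finset.mem_sdiff.1 hg).2
    · rw [hred e he] at h
      rw [h]
  have hρL : ∀ q ∈ P, ρ q ∉ L := by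
    intro q hq h
    rcases hcases q hq with hq' | ⟨e, he, rfl⟩
    · rw [hblue q hq'] at h
      exact hLS _ h (hνS q hq').1
    · rw [hred e he] at h
      exact (Finset.mem_sdiff.1 he).2 h
  refine ⟨P, ρ, ?_, ?_, ?_, ?_, ?_, ?_⟩
  · rw [hP, Finset.card_union_of_disjoint, Finset.card_image_of_injOn hRinj]
    rw [Finset.disjoint_right]
    intro p hp
    obtain ⟨e, he, rfl⟩ := Finset.mem_image.1 hp
    exact hredS e he
  · intro p hp
    rcases hcases p hp with hp | ⟨e, he, rfl⟩
    · obtain ⟨_, _, _, h⟩ := mem_shad.1 hp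
      exact h
    · exact (hμv.2 e (hRU he)).2.1
  · intro p hp q hq h
    rcases hcases q hq with hq' | ⟨e, he, rfl⟩
    · rw [hblue q hq'] at h
      exact hρS p hp q hq' h
    · rw [hred e he] at h
      exact hρU p hp e (hRU he) h
  · intro p hp
    refine ⟨?_, hρL p hp⟩
    rcases hcases p hp with hp' | ⟨e, he, rfl⟩
    · rw [hblue p hp']
      exact hSH (hνS p hp').1
    · rw [hred e he]
      exact hRH e he
  · intro p hp
    rcases hcases p hp with hp' | ⟨e, he, rfl⟩
    · rw [hblue p hp']
      exact (hνS p hp').2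
    · rw [hred e he]
      exact (hμv.2 e (hRU he)).1
  · suffices h : ∀ p, ∃ w, p ∈ P → w ∉ p ∧ (p ∉ shad S → w ∈ ρ p) ∧ ExtAt H P ρ p w by
      choose w hw using h
      exact ⟨w, hw⟩
    intro p
    by_cases hpP : p ∈ P
    swap
    · exact ⟨Classical.arbitrary V, fun h => absurd h hpP⟩
    rcases hcases p hpP with hp | ⟨e, he, rfl⟩
    · obtain ⟨e, he, hpe, hp2⟩ := mem_shad.1 hp
      obtain ⟨w, hwp, hwe, hew⟩ := triple_of_pair (h3 e (hSH he)) hp2 hpe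
      refine ⟨w, fun _ => ⟨hwp, fun h => absurd hp h, ?_⟩⟩
      intro u v huv
      have hue : u ∈ e := hpe (by rw [huv]; simp)
      have hve : v ∈ e := hpe (by rw [huv]; simp)
      have huw : u ≠ w := by rintro rfl; apply hwp; rw [huv]; simp
      have hvw : v ≠ w := by rintro rfl; apply hwp; rw [huv]; simp
      have huv' : u ≠ v := by rintro rfl; rw [huv] at hp2; simp at hp2
      have hpair : ∀ x ∈ e, x ≠ w → ({x, w} : Finset V) ∈ shad S := by
        intro x hx hxw
        refine mem_shad.2 ⟨e, he, ?_, Finset.card_pair hxw⟩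
        intro z hz
        simp only [Finset.mem_insert, Finset.mem_singleton] at hz
        rcases hz with rfl | rfl
        · exact hx
        · exact hwe
      have hu := hpair u hue huw
      have hv := hpair v hve hvw
      refine ⟨ν {u, w}, hSH (hνS _ hu).1, ν {v, w}, hSH (hνS _ hv).1, ?_,
        (hνS _ hu).2 (by simp), (hνS _ hu).2 (by simp), (hνS _ hv).2 (by simp),
        (hνS _ hv).2 (by simp), ?_⟩
      · intro h
        have h' := hν hu hv h
        have : u ∈ ({v, w} : Finset V) := by rw [← h']; simp
        simp only [Finset.mem_insert, Finset.mem_singleton] at this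
        rcases this with h | h
        · exact huv' h
        · exact huw h
      · intro q hq _ hwq
        constructor
        · intro h
          apply hwq
          rw [hρS q hq _ hu h]; simp
        · intro h
          apply hwq
          rw [hρS q hq _ hv h]; simp
    · obtain ⟨hme, hmc, hmS⟩ := hμv.2 e (hRU he)
      obtain ⟨w, hwp, hwe, hew⟩ := triple_of_pair (h3 e (hRH e he)) hmc hme
      refine ⟨w, fun _ => ⟨hwp, fun _ => by rw [hred e he]; exact hwe, ?_⟩⟩
      intro u v huv
      have hue : u ∈ e := hme (by rw [huv]; simp)
      have hve : v ∈ e := hme (by rw [huv]; simp)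
      obtain ⟨p, hpe, hp2, hpm, g, hgH, hge, hpg, hg⟩ := hgood e he
      have hwp' : w ∈ p := by
        by_contra hwn
        apply hpm
        apply Finset.eq_of_subset_of_card_le _ (by omega)
        intro x hx
        have := hpe hx
        rw [hew, Finset.mem_insert] at this
        rcases this with rfl | h
        · exact absurd hx hwn
        · exact h
      have hqe : ∀ q ∈ P, q ≠ μ e → ρ q ≠ e := fun q hq hne h =>
        hne (hρU q hq e (hRU he) h)
      have hqg : ∀ q ∈ P, w ∉ q → ρ q ≠ g := by
        intro q hq hwq h
        rcases hg with hg | ⟨hgU, hgp⟩ | ⟨hpS, hgν⟩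
        · exact hρL q hq (h ▸ hg)
        · apply hwq
          rw [hρU q hq g hgU h, hgp]
          exact hwp'
        · apply hwq
          rw [hρS q hq p hpS (h.trans hgν)]
          exact hwp'
      have huvp : u ∈ p ∨ v ∈ p := by
        obtain ⟨x, hx, hxw⟩ : ∃ x ∈ p, x ≠ w := by
          by_contra hcon
          push Not at hcon
          have : p ⊆ {w} := fun x hx => by simpa using hcon x hx
          have := Finset.card_le_card this
          simp at this
          omega
        have := hpe hx
        rw [hew, huv] at this
        simp only [Finset.mem_insert, Finset.mem_singleton] at this
        rcases this with h | h | h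
        · exact absurd h hxw
        · left; rw [← h]; exact hx
        · right; rw [← h]; exact hx
      rcases huvp with h | h
      · exact ⟨g, hgH, e, hRH e he, hge, hpg h, hpg hwp', hve, hwe,
          fun q hq hne hwq => ⟨hqg q hq hwq, hqe q hq hne⟩⟩
      · exact ⟨e, hRH e he, g, hgH, hge.symm, hue, hwe, hpg h, hpg hwp',
          fun q hq hne hwq => ⟨hqe q hq hne, hqg q hq hwq⟩⟩

/-- Closing up a cycle through the apex of its closing edge. -/
lemma berge_of_ext (H P : Finset (Finset V)) (N : ℕ) (hN : 3 ≤ N) (v : ℕ → V)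
    (ρ : Finset V → Finset V) (hv : IsCyc P N v) (hρ : Set.InjOn ρ P)
    (hρH : ∀ p ∈ P, ρ p ∈ H) (hρp : ∀ p ∈ P, p ⊆ ρ p) (w : V) (hw : ∀ i < N, w ≠ v i)
    (hext : ExtAt H P ρ (cp N v (N - 1)) w) :
    HasBergeCopy (SimpleGraph.cycleGraph (N + 1)) H := by
  have e1 : nx N (N - 1) = 0 := by unfold nx; rw [if_neg (by omega)]
  obtain ⟨g1, hg1, g2, hg2, h12, h1, h1w, h2, h2w, hq⟩ := hext (v (N - 1)) (v 0) (by
    simp [cp, e1])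
  refine berge_of_cyc_ext H P N hN v ρ hv hρ hρH hρp w hw g1 g2 h12 hg1 hg2 h1 h1w h2 h2w ?_
  intro i hi
  apply hq _ (hv.2 i (by omega))
  · intro h
    have := cp_inj hN hv.1 i (by omega) (N - 1) (by omega) h
    omega
  · intro h
    simp only [cp, Finset.mem_insert, Finset.mem_singleton] at h
    rcases h with h | h
    · exact hw i (by omega) h
    · exact hw _ (nx_lt (by omega)) h

/-- Averaging over the halves of the vertex set. -/
lemma averaging_s2 [Fintype V] (m r c : ℕ) (hm : 2 ≤ m) (hV : Fintype.card V = 2 * m)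
    (P : Finset (Finset V)) (Z : Finset V → Finset V) (hP : ∀ p ∈ P, p.card = 2)
    (hZ : ∀ p ∈ P, (Z p).card = r) (hd : ∀ p ∈ P, Disjoint p (Z p))
    (hc : ∀ A : Finset V, A.card = m →
      (P.filter (fun p => p ⊆ A ∧ Disjoint (Z p) A)).card ≤ c) :
    P.card * (2 * m - 2 - r).choose (m - 2) ≤ (2 * m).choose m * c := by
  have h := Finset.sum_card_bipartiteAbove_eq_sum_card_bipartiteBelow
    (s := P) (t := (Finset.univ : Finset V).powersetCard m)
    (fun p A => p ⊆ A ∧ Disjoint (Z p) A)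
  simp only [Finset.bipartiteAbove, Finset.bipartiteBelow] at h
  have h1 : P.card * (2 * m - 2 - r).choose (m - 2) ≤
      ∑ p ∈ P, (((Finset.univ : Finset V).powersetCard m).filter
        (fun A => p ⊆ A ∧ Disjoint (Z p) A)).card := by
    rw [← smul_eq_mul]
    apply Finset.card_nsmul_le_sum
    intro p hp
    have e1 : (2 * m - 2 - r).choose (m - 2) =
        ((Finset.univ \ (p ∪ Z p)).powersetCard (m - 2)).card := by
      rw [Finset.card_powersetCard, Finset.card_sdiff_of_subset (Finset.subset_univ _),
        Finset.card_union_of_disjoint (hd p hp), hP p hp, hZ p hp, Finset.card_univ, hV]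
      congr 1
      omega
    rw [e1]
    apply Finset.card_le_card_of_injOn (fun B => B ∪ p)
    · intro B hB
      have hB' := Finset.mem_powersetCard.1 hB
      have hBd : ∀ x ∈ B, x ∉ p ∧ x ∉ Z p := by
        intro x hx
        have := hB'.1 hx
        simpa [not_or] using this
      simp only [Finset.coe_filter, Finset.mem_powersetCard, Finset.subset_univ, true_and]
      refine ⟨?_, Finset.subset_union_right, ?_⟩
      · rw [Finset.card_union_of_disjoint, hB'.2, hP p hp]
        · omega
        · rw [Finset.disjoint_left]
          exact fun x hx => (hBd x hx).1
      · rw [Finset.disjoint_union_right]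
        refine ⟨?_, (hd p hp).symm⟩
        rw [Finset.disjoint_right]
        exact fun x hx => (hBd x hx).2
    · intro B hB B' hB' heq
      have key : ∀ B ∈ (Finset.univ \ (p ∪ Z p)).powersetCard (m - 2), (B ∪ p) \ p = B := by
        intro B hB
        have hB' := Finset.mem_powersetCard.1 hB
        apply Finset.union_sdiff_cancel_right
        rw [Finset.disjoint_left]
        intro x hx
        have := hB'.1 hx
        simp [not_or] at this
        exact this.1
      simp only at heq
      rw [← key B hB, ← key B' hB', heq]
  refine h1.trans ?_
  rw [h]
  refine (Finset.sum_le_card_nsmul _ _ c ?_).trans ?_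
  · intro A hA
    exact hc A (Finset.mem_powersetCard.1 hA).2
  · rw [Finset.card_powersetCard, Finset.card_univ, hV, smul_eq_mul]

lemma binom1 (j : ℕ) : (2 * (j + 2)).choose (j + 2) ≤ 8 * (2 * j + 1).choose j := by
  have h1 := Nat.succ_mul_centralBinom_succ (j + 1)
  have h2 : (j + 1).centralBinom = 2 * (2 * j + 1).choose j := by
    rw [Nat.centralBinom_eq_two_mul_choose, show 2 * (j + 1) = (2 * j + 1) + 1 by ring,
      Nat.choose_succ_succ]
    have := Nat.choose_symm_half j
    rw [Nat.succ_eq_add_one]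
    omega
  rw [h2] at h1
  rw [← Nat.centralBinom_eq_two_mul_choose]
  have : (j + 2) * (j + 2).centralBinom ≤ (j + 2) * (8 * (2 * j + 1).choose j) := by
    have h1' : (j + 2) * (j + 2).centralBinom =
      2 * (2 * (j + 1) + 1) * (2 * (2 * j + 1).choose j) := h1
    rw [h1']
    nlinarith [Nat.zero_le ((2 * j + 1).choose j)]
  exact Nat.le_of_mul_le_mul_left this (by omega)

lemma binom2 (j : ℕ) (hj : 1 ≤ j) :
    3 * (2 * (j + 2)).choose (j + 2) ≤ 16 * (2 * j + 2).choose j := by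
  have h1 := Nat.succ_mul_centralBinom_succ (j + 1)
  have h2 := Nat.choose_succ_right_eq (2 * j + 2) j
  rw [show 2 * j + 2 - j = j + 2 by omega, show 2 * j + 2 = 2 * (j + 1) by ring,
    ← Nat.centralBinom_eq_two_mul_choose] at h2
  rw [← Nat.centralBinom_eq_two_mul_choose, show 2 * j + 2 = 2 * (j + 1) by ring]
  set C := (2 * (j + 1)).choose j
  have h1' : (j + 2) * (j + 2).centralBinom = 2 * (2 * (j + 1) + 1) * (j + 1).centralBinom := h1
  have : ((j + 1) * (j + 2)) * (3 * (j + 2).centralBinom) ≤ ((j + 1) * (j + 2)) * (16 * C) := by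
    calc ((j + 1) * (j + 2)) * (3 * (j + 2).centralBinom)
        = 3 * (j + 1) * ((j + 2) * (j + 2).centralBinom) := by ring
      _ = 6 * (2 * j + 3) * ((j + 1).centralBinom * (j + 1)) := by rw [h1']; ring
      _ = (6 * (2 * j + 3)) * (C * (j + 2)) := by rw [h2]
      _ ≤ (16 * (j + 1)) * (C * (j + 2)) := Nat.mul_le_mul_right _ (by omega)
      _ = _ := by ring
  exact Nat.le_of_mul_le_mul_left this (by positivity)

end Ext

/-! ### The main estimate -/

section Main

variable {V : Type*} [DecidableEq V]

lemma max_linear (U L0 : Finset (Finset V)) (h3 : ∀ e ∈ U, e.card = 3) (hL0 : L0 ⊆ U)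
    (hlin : IsLinear L0) :
    ∃ L, L0 ⊆ L ∧ L ⊆ U ∧ IsLinear L ∧ ∀ e ∈ U \ L, ∃ f ∈ L, (f ∩ e).card = 2 := by
  classical
  obtain ⟨L, hL, hmax⟩ := Finset.exists_max_image
    (U.powerset.filter (fun L => L0 ⊆ L ∧ IsLinear L)) Finset.card
    ⟨L0, by simp [hL0, hlin]⟩
  simp only [Finset.mem_filter, Finset.mem_powerset] at hL hmax
  obtain ⟨hLU, hL0L, hLl⟩ := hL
  refine ⟨L, hL0L, hLU, hLl, fun e he => ?_⟩
  rw [Finset.mem_sdiff] at he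
  by_contra hcon
  push Not at hcon
  have hle : ∀ f ∈ L, (f ∩ e).card ≤ 1 := by
    intro f hf
    have hfe : f ≠ e := by rintro rfl; exact he.2 hf
    have h1 : (f ∩ e).card ≤ 3 := by
      rw [← h3 e he.1]; exact Finset.card_le_card Finset.inter_subset_right
    have h2 : (f ∩ e).card ≠ 3 := by
      intro h
      apply hfe
      have a1 : f ∩ e = f := Finset.eq_of_subset_of_card_le Finset.inter_subset_left (by
        rw [h, h3 f (hLU hf)])
      have a2 : f ∩ e = e := Finset.eq_of_subset_of_card_le Finset.inter_subset_right (by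
        rw [h, h3 e he.1])
      rw [← a1, a2]
    have := hcon f hf
    omega
  have := hmax (insert e L) ⟨by
      intro x hx
      rw [Finset.mem_insert] at hx
      rcases hx with rfl | hx
      · exact he.1
      · exact hLU hx, hL0L.trans (Finset.subset_insert _ _), by
      intro a ha b hb hab
      rw [Finset.mem_insert] at ha hb
      rcases ha with rfl | ha
      · rcases hb with rfl | hb
        · exact absurd rfl hab
        · rw [Finset.inter_comm]; exact hle b hb
      · rcases hb with rfl | hb
        · exact hle a ha
        · exact hLl a ha b hb hab⟩
  rw [Finset.card_insert_of_notMem he.2] at this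
  omega

lemma small_case [Fintype V] (m : ℕ) (hm : m < 2) (hV : Fintype.card V = 2 * m)
    (H : Finset (Finset V)) (h3 : ∀ e ∈ H, e.card = 3) : H = ∅ := by
  rw [Finset.eq_empty_iff_forall_notMem]
  intro e he
  have := h3 e he
  have := Finset.card_le_univ e
  omega

lemma main_large [Fintype V] (k m : ℕ) (hk : 3 ≤ k) (hV : Fintype.card V = 2 * m)
    (H : Finset (Finset V)) (h3 : ∀ e ∈ H, e.card = 3)
    (hno : ¬ HasBergeCopy (SimpleGraph.cycleGraph (2 * k + 1)) H) :
    ∃ L ⊆ H, IsLinear L ∧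
      3 * H.card ≤ 16 * (k - 1) * exTuran m (SimpleGraph.cycleGraph (2 * k)) + 3 * L.card := by
  classical
  rcases Nat.lt_or_ge m 2 with hm | hm
  · have := small_case m hm hV H h3
    subst this
    exact ⟨∅, by simp, by intro a ha; simp at ha, by simp⟩
  have hne : Nonempty V := by
    rw [← Fintype.card_pos_iff]; omega
  obtain ⟨S, hSH, ⟨ν, hν, hνS⟩, hμ⟩ := split_lemma H
  obtain ⟨L, -, hLU, hLl, hLm⟩ := max_linear (H \ S) ∅
    (fun e he => h3 e (Finset.mem_sdiff.1 he).1) (by simp) (by intro a ha; simp at ha)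
  obtain ⟨P, ρ, hPc, hP2, hρ, hρH, hρp, w, hw⟩ := ext_lemma H S L hSH h3 ν hν hνS hLU hLm hμ
  have hb := blue_count k (by omega) H S hSH h3 hno ν hν hνS
  have hav := averaging_s2 m 1 (exTuran m (SimpleGraph.cycleGraph (2 * k))) hm hV P
    (fun p => {w p}) hP2 (fun p _ => Finset.card_singleton _)
    (fun p hp => Finset.disjoint_singleton_right.2 (hw p hp).1) (by
      intro A hA
      rw [← hA]
      apply turan_bound_s2 (2 * k) (by omega)
      · intro p hp
        rw [Finset.mem_filter] at hp
        exact ⟨hp.2.1, hP2 p hp.1⟩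
      · intro v hv
        apply hno
        have hv' : ∀ i < 2 * k, cp (2 * k) v i ∈ P ∧ cp (2 * k) v i ⊆ A ∧
            w (cp (2 * k) v i) ∉ A := by
          intro i hi
          have := hv.2 i hi
          rw [Finset.mem_filter, Finset.disjoint_singleton_left] at this
          exact this
        refine berge_of_ext H P (2 * k) (by omega) v ρ ⟨hv.1, fun i hi => (hv' i hi).1⟩ hρ
          (fun p hp => (hρH p hp).1) hρp (w (cp (2 * k) v (2 * k - 1))) ?_
          (hw _ (hv' _ (by omega)).1).2.2
        intro i hi h
        apply (hv' (2 * k - 1) (by omega)).2.2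
        rw [h]
        exact (hv' i hi).2.1 (by simp [cp]))
  have hP8 : P.card ≤ 8 * exTuran m (SimpleGraph.cycleGraph (2 * k)) := by
    obtain ⟨j, rfl⟩ : ∃ j, m = j + 2 := ⟨m - 2, by omega⟩
    rw [show 2 * (j + 2) - 2 - 1 = 2 * j + 1 by omega, show j + 2 - 2 = j by omega] at hav
    have hbin := binom1 j
    have hpos : 0 < (2 * j + 1).choose j := Nat.choose_pos (by omega)
    have := hav.trans (Nat.mul_le_mul_right _ hbin)
    apply Nat.le_of_mul_le_mul_right _ hpos
    calc _ ≤ _ := this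
      _ = _ := by ring
  refine ⟨L, hLU.trans Finset.sdiff_subset, hLl, ?_⟩
  have c1 := Finset.card_sdiff_add_card_eq_card hSH
  have c2 := Finset.card_sdiff_add_card_eq_card hLU
  obtain ⟨j, rfl⟩ : ∃ j, k = j + 3 := ⟨k - 3, by omega⟩
  rw [show j + 3 - 1 = j + 2 by omega] at hb ⊢
  set X := exTuran m (SimpleGraph.cycleGraph (2 * (j + 3)))
  have : 2 * (j + 2) * P.card ≤ 2 * (j + 2) * (8 * X) := Nat.mul_le_mul_left _ hP8
  rw [hPc] at this
  nlinarith

lemma berge5 (H : Finset (Finset V)) (a b c d e : V) (g0 g1 g2 g3 g4 : Finset V)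
    (hv : [a, b, c, d, e].Nodup) (hg : [g0, g1, g2, g3, g4].Nodup)
    (hH : ∀ g ∈ [g0, g1, g2, g3, g4], g ∈ H)
    (h0 : a ∈ g0 ∧ b ∈ g0) (h1 : b ∈ g1 ∧ c ∈ g1) (h2 : c ∈ g2 ∧ d ∈ g2)
    (h3 : d ∈ g3 ∧ e ∈ g3) (h4 : e ∈ g4 ∧ a ∈ g4) :
    HasBergeCopy (SimpleGraph.cycleGraph 5) H := by
  refine berge_of_seq H 5 (by omega) (fun i => [a, b, c, d, e].getD i a)
    (fun i => [g0, g1, g2, g3, g4].getD i g0) ?_ ?_ ?_ ?_ ?_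
  · intro i hi j hj h
    beta_reduce at h
    rw [List.getD_eq_getElem _ _ (by simpa using hi),
      List.getD_eq_getElem _ _ (by simpa using hj)] at h
    exact (List.Nodup.getElem_inj_iff hv).1 h
  · intro i hi j hj h
    beta_reduce at h
    rw [List.getD_eq_getElem _ _ (by simpa using hi),
      List.getD_eq_getElem _ _ (by simpa using hj)] at h
    exact (List.Nodup.getElem_inj_iff hg).1 h
  · intro i hi
    beta_reduce
    rw [List.getD_eq_getElem _ _ (by simpa using hi)]
    exact hH _ (List.getElem_mem _)
  · intro i hi
    interval_cases i <;> simp [h0, h1, h2, h3, h4]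
  · intro i hi
    interval_cases i <;> simp [nx, h0, h1, h2, h3, h4]

lemma K4_inter (H : Finset (Finset V))
    (hno : ¬ HasBergeCopy (SimpleGraph.cycleGraph 5) H) (Q Q' : Finset V) (hQ : Q.card = 4)
    (hQ' : Q'.card = 4) (hQH : ∀ t ⊆ Q, t.card = 3 → t ∈ H)
    (hQH' : ∀ t ⊆ Q', t.card = 3 → t ∈ H) (hne : Q ≠ Q') : (Q ∩ Q').card ≤ 1 := by
  by_contra hcon
  have hlt : (Q ∩ Q').card ≠ 4 := by
    intro h
    apply hne
    have a1 : Q ∩ Q' = Q := Finset.eq_of_subset_of_card_le Finset.inter_subset_left (by omega)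
    have a2 : Q ∩ Q' = Q' := Finset.eq_of_subset_of_card_le Finset.inter_subset_right (by omega)
    rw [← a1, a2]
  have hle : (Q ∩ Q').card ≤ 4 := by
    rw [← hQ]; exact Finset.card_le_card Finset.inter_subset_left
  have d1 := Finset.card_sdiff_add_card_inter Q Q'
  have d2 := Finset.card_sdiff_add_card_inter Q' Q
  rw [Finset.inter_comm Q' Q] at d2
  have tri : ∀ (R : Finset V), (∀ t ⊆ R, t.card = 3 → t ∈ H) → ∀ x ∈ R, ∀ y ∈ R, ∀ z ∈ R,
      x ≠ y → x ≠ z → y ≠ z → ({x, y, z} : Finset V) ∈ H := by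
    intro R hR x hx y hy z hz h1 h2 h3
    apply hR
    · intro t ht
      simp only [Finset.mem_insert, Finset.mem_singleton] at ht
      rcases ht with rfl | rfl | rfl <;> assumption
    · exact Finset.card_eq_three.2 ⟨x, y, z, h1, h2, h3, rfl⟩
  have memI : ∀ x ∈ Q ∩ Q', x ∈ Q ∧ x ∈ Q' := fun x hx => Finset.mem_inter.1 hx
  have memD : ∀ x ∈ Q \ Q', x ∈ Q ∧ x ∉ Q' := fun x hx => Finset.mem_sdiff.1 hx
  have memD' : ∀ x ∈ Q' \ Q, x ∈ Q' ∧ x ∉ Q := fun x hx => Finset.mem_sdiff.1 hx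
  have hneq : ∀ x y, x ∈ Q → y ∉ Q → x ≠ y := by rintro x y hx hy rfl; exact hy hx
  have hneq' : ∀ x y, x ∈ Q' → y ∉ Q' → x ≠ y := by rintro x y hx hy rfl; exact hy hx
  obtain hc | hc : (Q ∩ Q').card = 3 ∨ (Q ∩ Q').card = 2 := by omega
  · obtain ⟨x, y, z, hxy, hxz, hyz, hI⟩ := Finset.card_eq_three.1 hc
    obtain ⟨p, hp⟩ := Finset.card_eq_one.1 (show (Q \ Q').card = 1 by omega)
    obtain ⟨q, hq⟩ := Finset.card_eq_one.1 (show (Q' \ Q).card = 1 by omega)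
    have mx := memI x (by rw [hI]; simp)
    have my := memI y (by rw [hI]; simp)
    have mz := memI z (by rw [hI]; simp)
    have mp := memD p (by rw [hp]; simp)
    have mq := memD' q (by rw [hq]; simp)
    have hxp := hneq' x p mx.2 mp.2
    have hyp := hneq' y p my.2 mp.2
    have hzp := hneq' z p mz.2 mp.2
    have hxq := hneq x q mx.1 mq.2
    have hyq := hneq y q my.1 mq.2
    have hzq := hneq z q mz.1 mq.2
    have hpq := hneq p q mp.1 mq.2
    refine hno (berge5 H q x p y z {x, y, q} {x, z, p} {x, y, p} {y, z, p} {y, z, q} ?_ ?_ ?_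
      (by simp) (by simp) (by simp) (by simp) (by simp))
    · simp [hxy, hxz, hyz, hxp.symm, hyp.symm, hzp.symm, hxq.symm, hyq.symm, hzq.symm, hpq.symm,
        hxp]
    · simp only [List.nodup_cons, List.mem_cons, List.not_mem_nil, not_or, Finset.ext_iff,
        Finset.mem_insert, Finset.mem_singleton]
      refine ⟨⟨?_, ?_, ?_, ?_, ?_⟩, ⟨?_, ?_, ?_, ?_⟩, ⟨?_, ?_, ?_⟩, ⟨?_, ?_⟩, ?_, ?_⟩ <;>
        first
        | simp; done
        | (intro h
           have i1 := h x
           have i2 := h y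
           have i3 := h z
           have i4 := h p
           have i5 := h q
           clear h
           grind)
    · intro g hg
      simp only [List.mem_cons, List.not_mem_nil, or_false] at hg
      rcases hg with rfl | rfl | rfl | rfl | rfl
      · exact tri Q' hQH' _ mx.2 _ my.2 _ mq.1 hxy hxq hyq
      · exact tri Q hQH _ mx.1 _ mz.1 _ mp.1 hxz hxp hzp
      · exact tri Q hQH _ mx.1 _ my.1 _ mp.1 hxy hxp hyp
      · exact tri Q hQH _ my.1 _ mz.1 _ mp.1 hyz hyp hzp
      · exact tri Q' hQH' _ my.2 _ mz.2 _ mq.1 hyz hyq hzq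
  · obtain ⟨x, y, hxy, hI⟩ := Finset.card_eq_two.1 hc
    obtain ⟨p, q, hpq, hp⟩ := Finset.card_eq_two.1 (show (Q \ Q').card = 2 by omega)
    obtain ⟨r, s, hrs, hq⟩ := Finset.card_eq_two.1 (show (Q' \ Q).card = 2 by omega)
    have mx := memI x (by rw [hI]; simp)
    have my := memI y (by rw [hI]; simp)
    have mp := memD p (by rw [hp]; simp)
    have mq := memD q (by rw [hp]; simp)
    have mr := memD' r (by rw [hq]; simp)
    have ms := memD' s (by rw [hq]; simp)
    have hxp := hneq' x p mx.2 mp.2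
    have hyp := hneq' y p my.2 mp.2
    have hxq := hneq' x q mx.2 mq.2
    have hyq := hneq' y q my.2 mq.2
    have hxr := hneq x r mx.1 mr.2
    have hyr := hneq y r my.1 mr.2
    have hxs := hneq x s mx.1 ms.2
    have hys := hneq y s my.1 ms.2
    have hpr := hneq p r mp.1 mr.2
    have hps := hneq p s mp.1 ms.2
    have hqr := hneq q r mq.1 mr.2
    have hqs := hneq q s mq.1 ms.2
    refine hno (berge5 H p x r y q {x, y, p} {x, r, s} {y, r, s} {x, y, q} {y, p, q} ?_ ?_ ?_
      (by simp) (by simp) (by simp) (by simp) (by simp))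
    · simp [hxy, hxp.symm, hpr, hyp.symm, hpq, hxr, hxq, hyr.symm, hqr.symm, hyq]
    · simp only [List.nodup_cons, List.mem_cons, List.not_mem_nil, not_or, Finset.ext_iff,
        Finset.mem_insert, Finset.mem_singleton]
      refine ⟨⟨?_, ?_, ?_, ?_, ?_⟩, ⟨?_, ?_, ?_, ?_⟩, ⟨?_, ?_, ?_⟩, ⟨?_, ?_⟩, ?_, ?_⟩ <;>
        first
        | simp; done
        | (intro h
           have i1 := h x
           have i2 := h y
           have i3 := h r
           have i4 := h p
           have i5 := h q
           have i6 := h s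
           clear h
           grind)
    · intro g hg
      simp only [List.mem_cons, List.not_mem_nil, or_false] at hg
      rcases hg with rfl | rfl | rfl | rfl | rfl
      · exact tri Q hQH _ mx.1 _ my.1 _ mp.1 hxy hxp hyp
      · exact tri Q' hQH' _ mx.2 _ mr.1 _ ms.1 hxr hxs hrs
      · exact tri Q' hQH' _ my.2 _ mr.1 _ ms.1 hyr hys hrs
      · exact tri Q hQH _ mx.1 _ my.1 _ mq.1 hxy hxq hyq
      · exact tri Q hQH _ my.1 _ mp.1 _ mq.1 hyp hyq hpq

lemma rotate_cyc (P : Finset (Finset V)) (v : ℕ → V) (hv : IsCyc P 4 v) (j : ℕ) (hj : j < 4) :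
    IsCyc P 4 (fun i => v ((i + j + 1) % 4)) ∧
      cp 4 (fun i => v ((i + j + 1) % 4)) 3 = cp 4 v j := by
  refine ⟨⟨?_, ?_⟩, ?_⟩
  · intro a ha b hb h
    have := hv.1 _ (Nat.mod_lt _ (by omega)) _ (Nat.mod_lt _ (by omega)) h
    omega
  · intro i hi
    have : cp 4 (fun i => v ((i + j + 1) % 4)) i = cp 4 v ((i + j + 1) % 4) := by
      interval_cases j <;> interval_cases i <;> simp [cp, nx]
    rw [this]
    exact hv.2 _ (Nat.mod_lt _ (by omega))
  · interval_cases j <;> simp [cp, nx]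

lemma main_two [Fintype V] (m : ℕ) (hV : Fintype.card V = 2 * m)
    (H : Finset (Finset V)) (h3 : ∀ e ∈ H, e.card = 3)
    (hno : ¬ HasBergeCopy (SimpleGraph.cycleGraph 5) H) :
    ∃ L ⊆ H, IsLinear L ∧
      3 * H.card ≤ 16 * exTuran m (SimpleGraph.cycleGraph 4) + 3 * L.card := by
  classical
  rcases Nat.lt_or_ge m 2 with hm | hm
  · have := small_case m hm hV H h3
    subst this
    exact ⟨∅, by simp, by intro a ha; simp at ha, by simp⟩
  have hne : Nonempty V := by
    rw [← Fintype.card_pos_iff]; omega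
  rcases Nat.eq_or_lt_of_le hm with hm2 | hm3
  · subst hm2
    refine ⟨∅, by simp, by intro a ha; simp at ha, ?_⟩
    have hH : H.card ≤ 4 := by
      have : H ⊆ (Finset.univ : Finset V).powersetCard 3 := by
        intro e he
        rw [Finset.mem_powersetCard]
        exact ⟨Finset.subset_univ _, h3 e he⟩
      have := Finset.card_le_card this
      rw [Finset.card_powersetCard, Finset.card_univ, hV] at this
      exact this
    obtain ⟨A, -, hA⟩ := Finset.exists_subset_card_eq
      (show 2 ≤ (Finset.univ : Finset V).card by rw [Finset.card_univ]; omega)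
    have := turan_bound_s2 4 (by omega) {A} A (by
      intro p hp
      rw [Finset.mem_singleton] at hp
      subst hp
      exact ⟨subset_rfl, hA⟩) (by
      intro v hv
      have a0 := hv.2 0 (by omega)
      have a1 := hv.2 1 (by omega)
      rw [Finset.mem_singleton] at a0 a1
      have := cp_inj (by omega) hv.1 0 (by omega) 1 (by omega) (a0.trans a1.symm)
      omega)
    rw [hA, Finset.card_singleton] at this
    omega
  obtain ⟨S, hSH, ⟨ν, hν, hνS⟩, hμ⟩ := split_lemma H
  have hb := blue_count 2 (by omega) H S hSH h3 hno ν hν hνS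
  have hb2 : (shad S).card ≤ S.card :=
    Finset.card_le_card_of_injOn ν (fun p hp => (hνS p hp).1) hν
  have hS : S = ∅ := by
    rw [← Finset.card_eq_zero]; omega
  subst hS
  set K := (Finset.univ : Finset (Finset V)).filter
    (fun Q => Q.card = 4 ∧ ∀ t ⊆ Q, t.card = 3 → t ∈ H) with hK
  have hKm : ∀ Q, Q ∈ K ↔ Q.card = 4 ∧ ∀ t ⊆ Q, t.card = 3 → t ∈ H := by
    intro Q; simp [hK]
  have hex : ∀ Q : Finset V, ∃ t : Finset V, Q ∈ K → t ⊆ Q ∧ t.card = 3 := by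
    intro Q
    by_cases hQ : Q ∈ K
    · obtain ⟨t, ht, htc⟩ := Finset.exists_subset_card_eq
        (show 3 ≤ Q.card by rw [((hKm Q).1 hQ).1]; omega)
      exact ⟨t, fun _ => ⟨ht, htc⟩⟩
    · exact ⟨∅, fun h => absurd h hQ⟩
  choose t ht using hex
  obtain ⟨L, hL0, hLU, hLl, hLm⟩ := max_linear (H \ ∅) (K.image t)
    (fun e he => h3 e (Finset.mem_sdiff.1 he).1) (by
      intro e he
      obtain ⟨Q, hQ, rfl⟩ := Finset.mem_image.1 he
      rw [Finset.sdiff_empty]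
      exact ((hKm Q).1 hQ).2 _ (ht Q hQ).1 (ht Q hQ).2) (by
      intro e he e' he' hne
      obtain ⟨Q, hQ, rfl⟩ := Finset.mem_image.1 he
      obtain ⟨Q', hQ', rfl⟩ := Finset.mem_image.1 he'
      have hQQ : Q ≠ Q' := by rintro rfl; exact hne rfl
      refine (Finset.card_le_card (Finset.inter_subset_inter (ht Q hQ).1 (ht Q' hQ').1)).trans ?_
      exact K4_inter H hno Q Q' ((hKm Q).1 hQ).1 ((hKm Q').1 hQ').1 ((hKm Q).1 hQ).2
        ((hKm Q').1 hQ').2 hQQ)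
  obtain ⟨P, ρ, hPc, hP2, hρ, hρH, hρp, w, hw⟩ := ext_lemma H ∅ L hSH h3 ν hν hνS hLU hLm hμ
  have hshad : shad (∅ : Finset (Finset V)) = ∅ := by simp [shad]
  have hwρ : ∀ p ∈ P, ρ p = insert (w p) p := by
    intro p hp
    have h1 : w p ∈ ρ p := (hw p hp).2.1 (by rw [hshad]; simp)
    symm
    apply Finset.eq_of_subset_of_card_le
    · exact Finset.insert_subset h1 (hρp p hp)
    · rw [h3 _ (hρH p hp).1, Finset.card_insert_of_notMem (hw p hp).1, hP2 p hp]
  have hfree : ∀ v, ¬ IsCyc P 4 v := by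
    intro v hv
    set Q := (Finset.range 4).image v with hQ
    have hvQ : ∀ i < 4, v i ∈ Q := fun i hi => Finset.mem_image_of_mem _ (by simpa using hi)
    have hQc : Q.card = 4 := by
      rw [hQ, Finset.card_image_of_injOn, Finset.card_range]
      intro a ha b hb h
      exact hv.1 a (by simpa using ha) b (by simpa using hb) h
    have hin : ∀ j < 4, ρ (cp 4 v j) ⊆ Q := by
      intro j hj
      have hp := hv.2 j hj
      rw [hwρ _ hp]
      apply Finset.insert_subset
      · by_contra hwQ
        obtain ⟨hv', hcp⟩ := rotate_cyc P v hv j hj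
        refine hno (berge_of_ext H P 4 (by omega) _ ρ hv' hρ (fun p hp => (hρH p hp).1) hρp
          (w (cp 4 v j)) ?_ ?_)
        · intro i hi h
          apply hwQ
          rw [h]
          exact hvQ _ (Nat.mod_lt _ (by omega))
        · change ExtAt H P ρ (cp 4 _ 3) _
          rw [hcp]
          exact (hw _ hp).2.2
      · intro x hx
        simp only [cp, Finset.mem_insert, Finset.mem_singleton] at hx
        rcases hx with rfl | rfl
        · exact hvQ _ hj
        · exact hvQ _ (nx_lt hj)
    have himg : (Finset.range 4).image (fun j => ρ (cp 4 v j)) = Q.powersetCard 3 := by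
      apply Finset.eq_of_subset_of_card_le
      · intro e he
        obtain ⟨j, hj, rfl⟩ := Finset.mem_image.1 he
        have hj' : j < 4 := by simpa using hj
        rw [Finset.mem_powersetCard]
        exact ⟨hin j hj', h3 _ (hρH _ (hv.2 j hj')).1⟩
      · rw [Finset.card_powersetCard, hQc, Finset.card_image_of_injOn, Finset.card_range]
        · decide
        · intro a ha b hb h
          have ha' : a < 4 := by simpa using ha
          have hb' : b < 4 := by simpa using hb
          exact cp_inj (by omega) hv.1 a ha' b hb' (hρ (hv.2 a ha') (hv.2 b hb') h)
    have htri : ∀ e ⊆ Q, e.card = 3 → e ∈ H ∧ e ∉ L := by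
      intro e he hec
      have : e ∈ Q.powersetCard 3 := Finset.mem_powersetCard.2 ⟨he, hec⟩
      rw [← himg] at this
      obtain ⟨j, hj, rfl⟩ := Finset.mem_image.1 this
      exact hρH _ (hv.2 j (by simpa using hj))
    have hQK : Q ∈ K := (hKm Q).2 ⟨hQc, fun e he hec => (htri e he hec).1⟩
    exact (htri _ (ht Q hQK).1 (ht Q hQK).2).2 (hL0 (Finset.mem_image_of_mem _ hQK))
  have hav := averaging_s2 m 0 (exTuran m (SimpleGraph.cycleGraph 4)) hm hV P
    (fun p => ∅) hP2 (fun p _ => Finset.card_empty) (fun p hp => Finset.disjoint_empty_right _) (by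
      intro A hA
      rw [← hA]
      apply turan_bound_s2 4 (by omega)
      · intro p hp
        rw [Finset.mem_filter] at hp
        exact ⟨hp.2.1, hP2 p hp.1⟩
      · intro v hv
        exact hfree v ⟨hv.1, fun i hi => (Finset.mem_filter.1 (hv.2 i hi)).1⟩)
  have hP8 : 3 * P.card ≤ 16 * exTuran m (SimpleGraph.cycleGraph 4) := by
    obtain ⟨j, rfl⟩ : ∃ j, m = j + 2 := ⟨m - 2, by omega⟩
    rw [show 2 * (j + 2) - 2 - 0 = 2 * j + 2 by omega, show j + 2 - 2 = j by omega] at hav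
    have hbin := binom2 j (by omega)
    have hpos : 0 < (2 * j + 2).choose j := Nat.choose_pos (by omega)
    set X := exTuran (j + 2) (SimpleGraph.cycleGraph 4)
    apply Nat.le_of_mul_le_mul_right _ hpos
    calc 3 * P.card * (2 * j + 2).choose j = 3 * (P.card * (2 * j + 2).choose j) := by ring
      _ ≤ 3 * ((2 * (j + 2)).choose (j + 2) * X) := Nat.mul_le_mul_left _ hav
      _ = (3 * (2 * (j + 2)).choose (j + 2)) * X := by ring
      _ ≤ (16 * (2 * j + 2).choose j) * X := Nat.mul_le_mul_right _ hbin
      _ = _ := by ring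
  have c2 := Finset.card_sdiff_add_card_eq_card hLU
  refine ⟨L, hLU.trans Finset.sdiff_subset, hLl, ?_⟩
  rw [hshad, Finset.card_empty] at hPc
  have c3 : (H \ ∅).card = H.card := by rw [Finset.sdiff_empty]
  omega

lemma main_lemma [Fintype V] (k m : ℕ) (hk : 1 < k) (hV : Fintype.card V = 2 * m)
    (H : Finset (Finset V)) (h3 : ∀ e ∈ H, e.card = 3)
    (hno : ¬ HasBergeCopy (SimpleGraph.cycleGraph (2 * k + 1)) H) :
    ∃ L ⊆ H, IsLinear L ∧
      3 * H.card ≤ 16 * (k - 1) * exTuran m (SimpleGraph.cycleGraph (2 * k)) + 3 * L.card := by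
  rcases Nat.eq_or_lt_of_le (show 2 ≤ k from hk) with rfl | hk3
  · exact main_two m hV H h3 hno
  · exact main_large k m hk3 hV H h3 hno

/-- Removing the parity restriction on the number of vertices. -/
lemma main_transfer (k n : ℕ) (hk : 1 < k)
    (H : Finset (Finset (Fin n))) (h3 : ∀ e ∈ H, e.card = 3)
    (hno : ¬ HasBergeCopy (SimpleGraph.cycleGraph (2 * k + 1)) H) :
    ∃ L ⊆ H, IsLinear L ∧ 3 * H.card ≤
      16 * (k - 1) * exTuran ((n + 1) / 2) (SimpleGraph.cycleGraph (2 * k)) + 3 * L.card := by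
  classical
  let ι : Fin n ↪ Fin (2 * ((n + 1) / 2)) := Fin.castLEEmb (by omega)
  let M : Finset (Fin n) ↪ Finset (Fin (2 * ((n + 1) / 2))) :=
    ⟨Finset.map ι, Finset.map_injective ι⟩
  have hH' : ∀ e ∈ H.map M, e.card = 3 := by
    intro e he
    obtain ⟨a, ha, rfl⟩ := Finset.mem_map.1 he
    change (Finset.map ι a).card = 3
    rw [Finset.card_map]
    exact h3 a ha
  have hno' : ¬ HasBergeCopy (SimpleGraph.cycleGraph (2 * k + 1)) (H.map M) := by
    rintro ⟨φ, f, hf, hfH⟩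
    apply hno
    have hfM : ∀ e, ∃ g ∈ H, Finset.map ι g = f e := by
      intro e
      obtain ⟨g, hg, hge⟩ := Finset.mem_map.1 (hfH e).1
      exact ⟨g, hg, hge⟩
    choose g hgH hgf using hfM
    have hφ : ∀ x, ∃ y, ι y = φ x := by
      intro x
      have hadj := cyc_adj_nx (N := 2 * k + 1) (by omega) x.1 x.2
      have hmem := (hfH ⟨s(_, _), (SimpleGraph.mem_edgeSet _).2 hadj⟩).2 x (by simp)
      rw [← hgf] at hmem
      obtain ⟨y, _, hy⟩ := Finset.mem_map.1 hmem
      exact ⟨y, hy⟩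
    choose ψ hψ using hφ
    refine ⟨⟨ψ, ?_⟩, g, ?_, ?_⟩
    · intro a b h
      apply φ.injective
      rw [← hψ, ← hψ, h]
    · intro a b h
      apply hf
      rw [← hgf, ← hgf, h]
    · intro e
      refine ⟨hgH e, fun x hx => ?_⟩
      have := (hfH e).2 x hx
      rw [← hgf, ← hψ, Finset.mem_map'] at this
      exact this
  obtain ⟨L', hL', hlin, hle⟩ := main_lemma k ((n + 1) / 2) hk (by simp) (H.map M) hH' hno'
  have hLL : (H.filter (fun e => M e ∈ L')).map M = L' := by
    ext e
    rw [Finset.mem_map]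
    constructor
    · rintro ⟨a, ha, rfl⟩
      exact (Finset.mem_filter.1 ha).2
    · intro he
      obtain ⟨a, ha, rfl⟩ := Finset.mem_map.1 (hL' he)
      exact ⟨a, Finset.mem_filter.2 ⟨ha, he⟩, rfl⟩
  refine ⟨H.filter (fun e => M e ∈ L'), Finset.filter_subset _ _, ?_, ?_⟩
  · intro a ha b hb hab
    have := hlin (M a) (Finset.mem_filter.1 ha).2 (M b) (Finset.mem_filter.1 hb).2
      (fun h => hab (M.injective h))
    change (Finset.map ι a ∩ Finset.map ι b).card ≤ 1 at this
    rw [← Finset.map_inter, Finset.card_map] at this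
    exact this
  · rw [Finset.card_map] at hle
    have h := Finset.card_map (s := H.filter (fun e => M e ∈ L')) M
    rw [hLL] at h
    rw [← h]
    exact hle

end Main

/-- For `k > 1`,
`ex_3(n, Berge-C_{2k+1}) ≤ ((16k-16)/3) · ex(⌈n/2⌉, C_{2k}) + ex_3^lin(n, Berge-C_{2k+1})`. -/
theorem berge_odd_cycle {k : ℕ} (hk : 1 < k) (n : ℕ) :
    (exBerge 3 n (SimpleGraph.cycleGraph (2 * k + 1)) : ℝ) ≤
      ((16 * (k : ℝ) - 16) / 3) * exTuran ((n + 1) / 2) (SimpleGraph.cycleGraph (2 * k)) +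
        exBergeLin 3 n (SimpleGraph.cycleGraph (2 * k + 1)) := by
  classical
  set c := SimpleGraph.cycleGraph (2 * k + 1) with hc
  have hempty : ¬ HasBergeCopy c (∅ : Finset (Finset (Fin n))) := by
    rintro ⟨φ, f, hf, hfH⟩
    have hadj := cyc_adj_nx (N := 2 * k + 1) (by omega) 0 (by omega)
    have := (hfH ⟨s(_, _), (SimpleGraph.mem_edgeSet _).2 hadj⟩).1
    simp at this
  have hbd : BddAbove {m | ∃ H : Finset (Finset (Fin n)), (∀ e ∈ H, e.card = 3) ∧
      ¬ HasBergeCopy c H ∧ H.card = m} :=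
    ⟨Fintype.card (Finset (Fin n)), by
      rintro m ⟨H, _, _, rfl⟩
      exact Finset.card_le_univ H⟩
  have hbd' : BddAbove {m | ∃ H : Finset (Finset (Fin n)), (∀ e ∈ H, e.card = 3) ∧ IsLinear H ∧
      ¬ HasBergeCopy c H ∧ H.card = m} :=
    ⟨Fintype.card (Finset (Fin n)), by
      rintro m ⟨H, _, _, _, rfl⟩
      exact Finset.card_le_univ H⟩
  obtain ⟨H, h3, hno, hHc⟩ : exBerge 3 n c ∈ {m | ∃ H : Finset (Finset (Fin n)),
      (∀ e ∈ H, e.card = 3) ∧ ¬ HasBergeCopy c H ∧ H.card = m} :=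
    Nat.sSup_mem ⟨0, ∅, by simp, hempty, by simp⟩ hbd
  obtain ⟨L, hLH, hlin, hle⟩ := main_transfer k n hk H h3 hno
  have hL : L.card ≤ exBergeLin 3 n c := by
    refine le_csSup hbd' ⟨L, fun e he => h3 e (hLH he), ?_, ?_, rfl⟩
    · intro a ha b hb hab
      convert hlin a ha b hb hab
    · rintro ⟨φ, f, hf, hfH⟩
      exact hno ⟨φ, f, hf, fun e => ⟨hLH (hfH e).1, (hfH e).2⟩⟩
  rw [← hHc]
  have hle' : (3 : ℝ) * H.card ≤ 16 * ((k : ℝ) - 1) *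
      exTuran ((n + 1) / 2) (SimpleGraph.cycleGraph (2 * k)) + 3 * L.card := by
    have h1 : ((k - 1 : ℕ) : ℝ) = (k : ℝ) - 1 := by
      rw [Nat.cast_sub hk.le]; simp
    rw [← h1]
    exact_mod_cast hle
  have hL' : (L.card : ℝ) ≤ exBergeLin 3 n c := by exact_mod_cast hL
  linarith
end
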